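/- Let X be a product system over ℕ² of nondegenerate regular A-correspondences with generating system (Y,θ), where Y_i = X_{e_i}. Then O_X ≅ O(Y_2 ⊗_A O_{Y_1}), where ℰY_2 = Y_2 ⊗_A O_{Y_1} is the O_{Y_1}-correspondence whose left action is determined by θ_{12}. -/

import Mathlib

/- ############################################################
   Common framework: C*-correspondences, interior tensor products
   (characterized relationally), representations, Cuntz–Pimsner algebras,
   product systems over ℕ^k, generating systems, and the ℰ / ℛθ
   constructions of the paper (characterized relationally).
   ############################################################ -/

noncomputable section

open Filter Topology

universe u

/-- A C*-correspondence over a (not necessarily unital) C*-algebra `A`: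
a right Hilbert `A`-module `X` together with a left action of `A` by
adjointable (bounded) operators.  The rank-one operators `θ_{x,y}` are
bundled as data together with their defining property. -/
structure Corr (A : Type u) [NonUnitalCStarAlgebra A] : Type (u + 1) where
  X : Type u
  [nacg : NormedAddCommGroup X]
  [nsp : NormedSpace ℂ X]
  [cmpl : CompleteSpace X]
  /-- right action of `A` -/
  ract : X → A → X
  /-- `A`-valued inner product -/
  inner : X → X → A
  /-- left action `φ : A → L(X)` by adjointable operators -/
  lactL : A → X →L[ℂ] X
  /-- the rank-one ("compact") operators `θ_{x,y} z = x ⬝ ⟨y, z⟩` -/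
  rankOne : X → X → X →L[ℂ] X
  ract_add_left : ∀ x y a, ract (x + y) a = ract x a + ract y a
  ract_add_right : ∀ x a b, ract x (a + b) = ract x a + ract x b
  ract_mul : ∀ x a b, ract x (a * b) = ract (ract x a) b
  ract_smul : ∀ (c : ℂ) x a, ract (c • x) a = c • ract x a
  ract_smul' : ∀ (c : ℂ) x a, ract x (c • a) = c • ract x a
  inner_add_right : ∀ x y z, inner x (y + z) = inner x y + inner x z
  inner_smul_right : ∀ (c : ℂ) x y, inner x (c • y) = c • inner x y
  inner_star : ∀ x y, star (inner x y) = inner y x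
  inner_ract_right : ∀ x y a, inner x (ract y a) = inner x y * a
  norm_eq : ∀ x, ‖x‖ ^ 2 = ‖inner x x‖
  lact_add : ∀ a b, lactL (a + b) = lactL a + lactL b
  lact_mul : ∀ a b, lactL (a * b) = (lactL a).comp (lactL b)
  lact_smul : ∀ (c : ℂ) a, lactL (c • a) = c • lactL a
  lact_adjoint : ∀ a x y, inner (lactL a x) y = inner x (lactL (star a) y)
  rankOne_apply : ∀ x y z, rankOne x y z = ract x (inner y z)

attribute [instance] Corr.nacg Corr.nsp Corr.cmpl

variable {A : Type u} [NonUnitalCStarAlgebra A]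

/-- Nondegeneracy: `A·X` is (topologically) all of `X`. -/
def Corr.Nondeg (W : Corr A) : Prop :=
  closure (Submodule.span ℂ {y : W.X | ∃ a x, y = W.lactL a x} : Set W.X) = Set.univ

/-- Regularity: the left action is injective and takes values in the
compact operators (the closed span of the rank-one operators). -/
def Corr.Regular (W : Corr A) : Prop :=
  (∀ a, W.lactL a = 0 → a = 0) ∧
    ∀ a, W.lactL a ∈
      closure (Submodule.span ℂ {T : W.X →L[ℂ] W.X | ∃ x y, T = W.rankOne x y} :
        Set (W.X →L[ℂ] W.X))

/-- standing hypotheses of the paper: nondegenerate and regular -/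
def Corr.Reg (W : Corr A) : Prop := W.Nondeg ∧ W.Regular

/-- a bare function which is a continuous `ℂ`-linear map -/
structure IsCLMap {E F : Type u} [NormedAddCommGroup E] [NormedSpace ℂ E]
    [NormedAddCommGroup F] [NormedSpace ℂ F] (f : E → F) : Prop where
  map_add : ∀ x y, f (x + y) = f x + f y
  map_smul : ∀ (c : ℂ) x, f (c • x) = c • f x
  cont : Continuous f

/-- a map of correspondences over the same algebra which is an isomorphism -/
structure IsCorrIsoFun (W Z : Corr A) (f : W.X → Z.X) : Prop where
  bijective : Function.Bijective f
  map_add : ∀ x y, f (x + y) = f x + f y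
  map_smul : ∀ (c : ℂ) x, f (c • x) = c • f x
  map_inner : ∀ x y, Z.inner (f x) (f y) = W.inner x y
  map_ract : ∀ x a, f (W.ract x a) = Z.ract (f x) a
  map_lact : ∀ a x, f (W.lactL a x) = Z.lactL a (f x)

/-- an isomorphism of correspondences over the same algebra (bundled) -/
structure CorrIso (W Z : Corr A) : Type u where
  toFun : W.X → Z.X
  invFun : Z.X → W.X
  left_inv : ∀ x, invFun (toFun x) = x
  right_inv : ∀ y, toFun (invFun y) = y
  map_add : ∀ x y, toFun (x + y) = toFun x + toFun y
  map_smul : ∀ (c : ℂ) x, toFun (c • x) = c • toFun x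
  map_inner : ∀ x y, Z.inner (toFun x) (toFun y) = W.inner x y
  map_ract : ∀ x a, toFun (W.ract x a) = Z.ract (toFun x) a
  map_lact : ∀ a x, toFun (W.lactL a x) = Z.lactL a (toFun x)

/-- an isomorphism of correspondences lying over an isomorphism `Φ` of the
coefficient algebras -/
structure CorrIsoOver {B : Type u} [NonUnitalCStarAlgebra B]
    (Φ : A → B) (W : Corr A) (Z : Corr B) : Type u where
  toFun : W.X → Z.X
  bijective : Function.Bijective toFun
  map_add : ∀ x y, toFun (x + y) = toFun x + toFun y
  map_smul : ∀ (c : ℂ) x, toFun (c • x) = c • toFun x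
  map_inner : ∀ x y, Z.inner (toFun x) (toFun y) = Φ (W.inner x y)
  map_ract : ∀ x a, toFun (W.ract x a) = Z.ract (toFun x) (Φ a)
  map_lact : ∀ a x, toFun (W.lactL a x) = Z.lactL (Φ a) (toFun x)

/-- `T`, together with the bilinear map `m`, is a realization of the
balanced (interior) tensor product `W ⊗_A V` of correspondences over `A`. -/
structure IsTensor (W V T : Corr A) (m : W.X → V.X → T.X) : Prop where
  add_left : ∀ x x' y, m (x + x') y = m x y + m x' y
  add_right : ∀ x y y', m x (y + y') = m x y + m x y'
  smul_left : ∀ (c : ℂ) x y, m (c • x) y = c • m x y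
  smul_right : ∀ (c : ℂ) x y, m x (c • y) = c • m x y
  balanced : ∀ x a y, m (W.ract x a) y = m x (V.lactL a y)
  inner : ∀ x y x' y',
    T.inner (m x y) (m x' y') = V.inner y (V.lactL (W.inner x x') y')
  ract : ∀ x y a, T.ract (m x y) a = m x (V.ract y a)
  lact : ∀ a x y, T.lactL a (m x y) = m (W.lactL a x) y
  dense : closure (Submodule.span ℂ {z : T.X | ∃ x y, z = m x y} : Set T.X) = Set.univ

variable {B : Type u} [NonUnitalCStarAlgebra B]

/-- `π : A → B` is a *-homomorphism (stated elementwise) -/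
structure IsStarHom (π : A → B) : Prop where
  map_add : ∀ a b, π (a + b) = π a + π b
  map_mul : ∀ a b, π (a * b) = π a * π b
  map_star : ∀ a, π (star a) = star (π a)
  map_smul : ∀ (c : ℂ) a, π (c • a) = c • π a

/-- `(π, t)` is a representation (Toeplitz representation) of the
correspondence `W` in the C*-algebra `B`. -/
structure IsRep (W : Corr A) (π : A → B) (t : W.X → B) : Prop where
  hom : IsStarHom π
  t_add : ∀ x y, t (x + y) = t x + t y
  t_smul : ∀ (c : ℂ) x, t (c • x) = c • t x
  lact : ∀ a x, t (W.lactL a x) = π a * t x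
  ract : ∀ x a, t (W.ract x a) = t x * π a
  inner : ∀ x y, star (t x) * t y = π (W.inner x y)

/-- Cuntz–Pimsner covariance of a representation of a *regular*
correspondence: whenever `φ(a)` is approximated in norm by finite sums of
rank-one operators `θ_{x,y}`, `π(a)` is approximated by the corresponding
sums `t(x) t(y)*`.  (For regular correspondences this is equivalent to
`π = t⁽¹⁾ ∘ φ`.) -/
def CPCov (W : Corr A) (π : A → B) (t : W.X → B) : Prop :=
  ∀ (a : A) (N : ℕ → ℕ) (x y : ∀ n, Fin (N n) → W.X),
    Tendsto (fun n => ∑ r, W.rankOne (x n r) (y n r)) atTop (𝓝 (W.lactL a)) →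
    Tendsto (fun n => ∑ r, t (x n r) * star (t (y n r))) atTop (𝓝 (π a))

/-- The Cuntz–Pimsner algebra of a correspondence `W`: a C*-algebra `O`
together with a universal covariant representation `(π, t)`:  `(π,t)` is
covariant, `π` is injective, `O` is generated by the images of `π` and `t`,
and every covariant representation factors uniquely through `O`. -/
structure CPAlg (W : Corr A) : Type (u + 1) where
  O : Type u
  [alg : NonUnitalCStarAlgebra O]
  π : A → O
  t : W.X → O
  isRep : IsRep W π t
  covariant : CPCov W π t
  inj : Function.Injective π
  gen : ∀ S : Set O, IsClosed S →
    (∀ a, π a ∈ S) → (∀ x, t x ∈ S) →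
    (∀ p q, p ∈ S → q ∈ S → p + q ∈ S) →
    (∀ p q, p ∈ S → q ∈ S → p * q ∈ S) →
    (∀ (c : ℂ) p, p ∈ S → c • p ∈ S) →
    (∀ p, p ∈ S → star p ∈ S) → ∀ z, z ∈ S
  universal : ∀ (C : Type u) [NonUnitalCStarAlgebra C],
    ∀ (π' : A → C) (t' : W.X → C), IsRep W π' t' → CPCov W π' t' →
      ∃! h : O →⋆ₙₐ[ℂ] C, (∀ a, h (π a) = π' a) ∧ ∀ x, h (t x) = t' x

attribute [instance] CPAlg.alg

/- ##################  product systems over ℕ^k  ################## -/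

/-- the `i`-th standard generator of `ℕ^k` -/
def egen {k : ℕ} (i : Fin k) : Fin k → ℕ := Pi.single i 1

/-- A product system over `ℕ^k` of (nondegenerate regular) correspondences
over `A`:  fibers `fib s`, an associative multiplication implementing
isomorphisms `fib s ⊗_A fib t ≅ fib (s+t)`, and `fib 0 = A` (witnessed by
the unit map). -/
structure PSys (A : Type u) [NonUnitalCStarAlgebra A] (k : ℕ) : Type (u + 1) where
  fib : (Fin k → ℕ) → Corr A
  reg : ∀ s, (fib s).Reg
  mul : ∀ s t, (fib s).X → (fib t).X → (fib (s + t)).X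
  isTensor : ∀ s t, IsTensor (fib s) (fib t) (fib (s + t)) (mul s t)
  assoc : ∀ s t u x y z,
    HEq (mul (s + t) u (mul s t x y) z) (mul s (t + u) x (mul t u y z))
  unit : A → (fib 0).X
  unit_bij : Function.Bijective unit
  unit_add : ∀ a b, unit (a + b) = unit a + unit b
  unit_smul : ∀ (c : ℂ) a, unit (c • a) = c • unit a
  unit_inner : ∀ a b, (fib 0).inner (unit a) (unit b) = star a * b
  unit_lact : ∀ a b, (fib 0).lactL a (unit b) = unit (a * b)
  unit_ract : ∀ a b, (fib 0).ract (unit a) b = unit (a * b)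
  unit_mul_left : ∀ s a x, HEq (mul 0 s (unit a) x) ((fib s).lactL a x)
  unit_mul_right : ∀ s x a, HEq (mul s 0 x (unit a)) ((fib s).ract x a)

/-- a representation of a product system in a C*-algebra `B` -/
structure PSRep {k : ℕ} (Xs : PSys A k) (B : Type u) [NonUnitalCStarAlgebra B] :
    Type u where
  π : A → B
  ψ : ∀ s, (Xs.fib s).X → B
  isRep : ∀ s, IsRep (Xs.fib s) π (ψ s)
  ψ_zero : ∀ a, ψ 0 (Xs.unit a) = π a
  mul : ∀ s t x y, ψ s x * ψ t y = ψ (s + t) (Xs.mul s t x y)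

/-- Cuntz–Pimsner covariance of a representation of a product system -/
def PSCPCov {k : ℕ} {Xs : PSys A k} {B : Type u} [NonUnitalCStarAlgebra B]
    (r : PSRep Xs B) : Prop :=
  ∀ s, CPCov (Xs.fib s) r.π (r.ψ s)

/-- The Cuntz–Pimsner algebra `𝒪(X)` of a product system. -/
structure PSCPAlg {k : ℕ} (Xs : PSys A k) : Type (u + 1) where
  O : Type u
  [alg : NonUnitalCStarAlgebra O]
  rep : PSRep Xs O
  covariant : PSCPCov rep
  inj : Function.Injective rep.π
  gen : ∀ S : Set O, IsClosed S →
    (∀ a, rep.π a ∈ S) → (∀ s x, rep.ψ s x ∈ S) →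
    (∀ p q, p ∈ S → q ∈ S → p + q ∈ S) →
    (∀ p q, p ∈ S → q ∈ S → p * q ∈ S) →
    (∀ (c : ℂ) p, p ∈ S → c • p ∈ S) →
    (∀ p, p ∈ S → star p ∈ S) → ∀ z, z ∈ S
  universal : ∀ (C : Type u) [NonUnitalCStarAlgebra C],
    ∀ r : PSRep Xs C, PSCPCov r →
      ∃! h : O →⋆ₙₐ[ℂ] C,
        (∀ a, h (rep.π a) = r.π a) ∧ ∀ s x, h (rep.ψ s x) = r.ψ s x

attribute [instance] PSCPAlg.alg

/- ##################  generating systems  ################## -/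

/-- a realization of a triple tensor product `W1 ⊗ W2 ⊗ W3` carrying both
a left pairing `(W1 ⊗ W2) ⊗ W3` and a right pairing `W1 ⊗ (W2 ⊗ W3)` -/
structure Trip (W1 W2 W3 : Corr A) (T12 : Corr A) (m12 : W1.X → W2.X → T12.X)
    (T23 : Corr A) (m23 : W2.X → W3.X → T23.X) (P : Corr A) : Type u where
  lp : T12.X → W3.X → P.X
  rp : W1.X → T23.X → P.X
  lt : IsTensor T12 W3 P lp
  rt : IsTensor W1 T23 P rp
  compat : ∀ x y z, lp (m12 x y) z = rp x (m23 y z)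

/-- the hexagonal relation for a triple of flip isomorphisms
`θij, θil, θjl`, stated relative to arbitrary realizations of the six
triple tensor products. -/
def HexProp (Yi Yj Yl : Corr A)
    (Tij Tji Til Tli Tjl Tlj : Corr A)
    (mij : Yi.X → Yj.X → Tij.X) (mji : Yj.X → Yi.X → Tji.X)
    (mil : Yi.X → Yl.X → Til.X) (mli : Yl.X → Yi.X → Tli.X)
    (mjl : Yj.X → Yl.X → Tjl.X) (mlj : Yl.X → Yj.X → Tlj.X)
    (θij : Tij.X → Tji.X) (θil : Til.X → Tli.X) (θjl : Tjl.X → Tlj.X) : Prop :=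
  ∀ (P1 P2 P3 P4 P5 P6 : Corr A)
    (R1 : Trip Yi Yj Yl Tij mij Tjl mjl P1)
    (R2 : Trip Yj Yi Yl Tji mji Til mil P2)
    (R3 : Trip Yj Yl Yi Tjl mjl Tli mli P3)
    (R4 : Trip Yl Yj Yi Tlj mlj Tji mji P4)
    (R5 : Trip Yi Yl Yj Til mil Tlj mlj P5)
    (R6 : Trip Yl Yi Yj Tli mli Tij mij P6)
    (F1 : P1.X → P2.X) (F2 : P2.X → P3.X) (F3 : P3.X → P4.X)
    (F4 : P1.X → P5.X) (F5 : P5.X → P6.X) (F6 : P6.X → P4.X),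
    IsCLMap F1 → IsCLMap F2 → IsCLMap F3 →
    IsCLMap F4 → IsCLMap F5 → IsCLMap F6 →
    (∀ u z, F1 (R1.lp u z) = R2.lp (θij u) z) →
    (∀ y v, F2 (R2.rp y v) = R3.rp y (θil v)) →
    (∀ u z, F3 (R3.lp u z) = R4.lp (θjl u) z) →
    (∀ x v, F4 (R1.rp x v) = R5.rp x (θjl v)) →
    (∀ u z, F5 (R5.lp u z) = R6.lp (θil u) z) →
    (∀ x v, F6 (R6.rp x v) = R4.rp x (θij v)) →
    ∀ w, F3 (F2 (F1 w)) = F6 (F5 (F4 w))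

/-- A generating system `(Y, θ)` of `k` correspondences over `A`:
correspondences `Y i`, chosen realizations `T i j` of the tensor products
`Y i ⊗_A Y j`, and flip isomorphisms `θ i j : Y i ⊗ Y j → Y j ⊗ Y i` with
`θ i i = id`, `θ j i = (θ i j)⁻¹`, satisfying the hexagonal relations. -/
structure GenSys (A : Type u) [NonUnitalCStarAlgebra A] (k : ℕ) : Type (u + 1) where
  Y : Fin k → Corr A
  reg : ∀ i, (Y i).Reg
  T : Fin k → Fin k → Corr A
  tmul : ∀ i j, (Y i).X → (Y j).X → (T i j).X
  isTensor : ∀ i j, IsTensor (Y i) (Y j) (T i j) (tmul i j)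
  θ : ∀ i j, CorrIso (T i j) (T j i)
  θ_diag : ∀ i x y, (θ i i).toFun (tmul i i x y) = tmul i i x y
  θ_symm : ∀ i j z, (θ j i).toFun ((θ i j).toFun z) = z
  hex : ∀ i j l, HexProp (Y i) (Y j) (Y l) (T i j) (T j i) (T i l) (T l i)
    (T j l) (T l j) (tmul i j) (tmul j i) (tmul i l) (tmul l i) (tmul j l)
    (tmul l j) ((θ i j).toFun) ((θ i l).toFun) ((θ j l).toFun)

/-- the generating system obtained by keeping only `Y 1, …, Y m` -/
def GenSys.restrict {k : ℕ} (G : GenSys A k) (m : ℕ) (h : m ≤ k) : GenSys A m where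
  Y i := G.Y (Fin.castLE h i)
  reg i := G.reg _
  T i j := G.T (Fin.castLE h i) (Fin.castLE h j)
  tmul i j := G.tmul _ _
  isTensor i j := G.isTensor _ _
  θ i j := G.θ _ _
  θ_diag i := G.θ_diag _
  θ_symm i j := G.θ_symm _ _
  hex i j l := G.hex _ _ _

/-- `X` is *the* product system (over `ℕ^k`) generated by the generating
system `G` (Fowler–Sims); witnessed by compatible isomorphisms on the
generating fibers. -/
structure Generates {k : ℕ} (G : GenSys A k) (Xs : PSys A k) : Type u where
  ι : ∀ i, CorrIso (G.Y i) (Xs.fib (egen i))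
  κ : ∀ i j, CorrIso (G.T i j) (Xs.fib (egen i + egen j))
  κ_mul : ∀ i j x y,
    (κ i j).toFun (G.tmul i j x y) =
      Xs.mul (egen i) (egen j) ((ι i).toFun x) ((ι j).toFun y)
  θ_compat : ∀ i j z,
    HEq ((κ j i).toFun ((G.θ i j).toFun z)) ((κ i j).toFun z)

/- ############  mixed tensor products `W ⊗_A O` and `W ⊗_A V`  ############ -/

/-- `Z` (a correspondence over the C*-algebra `O`), with map `m`, is a
realization of the right Hilbert `O`-module `W ⊗_A O`, where `O` is an
`A`-algebra via `πA`.  (No condition on the left action of `O` on `Z`.) -/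
structure MixedMod (W : Corr A) (O : Type u) [NonUnitalCStarAlgebra O]
    (πA : A → O) (Z : Corr O) (m : W.X → O → Z.X) : Prop where
  add_left : ∀ x x' S, m (x + x') S = m x S + m x' S
  add_right : ∀ x S S', m x (S + S') = m x S + m x S'
  smul_left : ∀ (c : ℂ) x S, m (c • x) S = c • m x S
  smul_right : ∀ (c : ℂ) x S, m x (c • S) = c • m x S
  balanced : ∀ x a S, m (W.ract x a) S = m x (πA a * S)
  ract : ∀ x S T, Z.ract (m x S) T = m x (S * T)
  inner : ∀ x S y T, Z.inner (m x S) (m y T) = star S * (πA (W.inner x y) * T)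
  dense : closure (Submodule.span ℂ {z : Z.X | ∃ x S, z = m x S} : Set Z.X) = Set.univ

/-- `P`, with pairing `p`, is a realization of the balanced tensor product
`W ⊗_A V` where `W` is a correspondence over `A` and `V` a correspondence
over the `A`-algebra `O` (via `πA`); the left `A`-action is `πA`-compatible. -/
structure MixedPair (W : Corr A) {O : Type u} [NonUnitalCStarAlgebra O]
    (πA : A → O) (V P : Corr O) (p : W.X → V.X → P.X) : Prop where
  add_left : ∀ x x' v, p (x + x') v = p x v + p x' v
  add_right : ∀ x v v', p x (v + v') = p x v + p x v'
  smul_left : ∀ (c : ℂ) x v, p (c • x) v = c • p x v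
  smul_right : ∀ (c : ℂ) x v, p x (c • v) = c • p x v
  balanced : ∀ x a v, p (W.ract x a) v = p x (V.lactL (πA a) v)
  inner : ∀ x v x' v',
    P.inner (p x v) (p x' v') = V.inner v (V.lactL (πA (W.inner x x')) v')
  ract : ∀ x v S, P.ract (p x v) S = p x (V.ract v S)
  lact_pi : ∀ a x v, P.lactL (πA a) (p x v) = p (W.lactL a x) v
  dense : closure (Submodule.span ℂ {z : P.X | ∃ x v, z = p x v} : Set P.X) = Set.univ

/- ############  the correspondence `ℰYᵢ = Yᵢ ⊗_A 𝒪(Y₁)`  ############ -/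

/-- `Z = Yi ⊗_A 𝒪(Y1)` with the left `𝒪(Y1)`-action determined by the flip
`θ : Y1 ⊗ Yi → Yi ⊗ Y1` (`T` and `T'` are realizations of these tensor
products):  `π(a)` acts by `φ(a) ⊗ 1`, and `t(x)·(y ⊗ S) = (1 ⊗ V)(θ ⊗ 1)
(x ⊗ y ⊗ S)`. -/
structure ECorrData (Y1 Yi : Corr A)
    (T : Corr A) (mT : Y1.X → Yi.X → T.X)
    (T' : Corr A) (mT' : Yi.X → Y1.X → T'.X)
    (θ : T.X → T'.X)
    (C : CPAlg Y1) (Z : Corr C.O) (m : Yi.X → C.O → Z.X) : Prop where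
  mod : MixedMod Yi C.O C.π Z m
  lact_pi : ∀ a y S, Z.lactL (C.π a) (m y S) = m (Yi.lactL a y) S
  lact_t : ∃ μ : T'.X → C.O → Z.X,
    (∀ S, IsCLMap fun u => μ u S) ∧
    (∀ y u S, μ (mT' y u) S = m y (C.t u * S)) ∧
    ∀ x y S, Z.lactL (C.t x) (m y S) = μ (θ (mT x y)) S

/-- `Z = Yi ⊗_A 𝒪(Y p)` for a generating system `G`, with left action
determined by `θ p i` -/
def ECorr {k : ℕ} (G : GenSys A k) (p i : Fin k) (C : CPAlg (G.Y p))
    (Z : Corr C.O) (m : (G.Y i).X → C.O → Z.X) : Prop :=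
  ECorrData (G.Y p) (G.Y i) (G.T p i) (G.tmul p i) (G.T i p) (G.tmul i p)
    ((G.θ p i).toFun) C Z m

/-- `Z = Y j ⊗_A 𝒪(Y 1 ∗ ⋯ ∗ Y m)` with the left action of the
Cuntz–Pimsner algebra of the product system determined on the generators
`σ i = ψ_{e i}` via the flips `θ i j` and the absorption maps. -/
structure EPCorr {k : ℕ} (G : GenSys A k) {m : ℕ} (hm : m ≤ k)
    (Xs : PSys A m) (gen : Generates (G.restrict m hm) Xs) (C : PSCPAlg Xs)
    (j : Fin k) (Z : Corr C.O) (mm : (G.Y j).X → C.O → Z.X) : Prop where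
  mod : MixedMod (G.Y j) C.O C.rep.π Z mm
  lact_pi : ∀ a y S, Z.lactL (C.rep.π a) (mm y S) = mm ((G.Y j).lactL a y) S
  lact_t : ∀ i : Fin m,
    ∃ μ : (G.T j (Fin.castLE hm i)).X → C.O → Z.X,
      (∀ S, IsCLMap fun u => μ u S) ∧
      (∀ y u S, μ (G.tmul j (Fin.castLE hm i) y u) S =
        mm y (C.rep.ψ (egen i) ((gen.ι i).toFun u) * S)) ∧
      ∀ x y S, Z.lactL (C.rep.ψ (egen i) ((gen.ι i).toFun x)) (mm y S) =
        μ ((G.θ (Fin.castLE hm i) j).toFun (G.tmul (Fin.castLE hm i) j x y)) S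

/- ############  the isomorphism `ℛθ = ν⁻¹ (θ ⊗ 1) ν`  ############ -/

/-- Witness data expressing that `R : Zi ⊗_O Zj → Zj ⊗_O Zi` is the map
`ℛθ_{ij} = ν_{ji}⁻¹ (θ_{ij} ⊗ 1_O) ν_{ij}` of the paper, where
`Zi = Yi ⊗_A O`, `O = 𝒪(Y1)`, and `ν_{ij} : (Yi ⊗ O) ⊗_O (Yj ⊗ O) ≅
Yi ⊗ Yj ⊗ O` is the canonical absorption isomorphism. -/
structure RTheta (O : Type u) [NonUnitalCStarAlgebra O] (πA : A → O)
    (Yi Yj : Corr A) (Tij Tji : Corr A)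
    (mij : Yi.X → Yj.X → Tij.X) (mji : Yj.X → Yi.X → Tji.X)
    (θij : Tij.X → Tji.X)
    (Zi Zj : Corr O) (mmi : Yi.X → O → Zi.X) (mmj : Yj.X → O → Zj.X)
    (TZ TZr : Corr O) (mZ : Zi.X → Zj.X → TZ.X) (mZr : Zj.X → Zi.X → TZr.X)
    (R : TZ.X → TZr.X) : Type (u + 1) where
  Pl : Corr O
  Pr : Corr O
  pij : Yi.X → Zj.X → Pl.X
  pji : Yj.X → Zi.X → Pr.X
  hp : MixedPair Yi πA Zj Pl pij
  hpr : MixedPair Yj πA Zi Pr pji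
  q : Tij.X → O → Pl.X
  qr : Tji.X → O → Pr.X
  hq : MixedMod Tij O πA Pl q
  hqr : MixedMod Tji O πA Pr qr
  q_compat : ∀ x y S, q (mij x y) S = pij x (mmj y S)
  q_compatr : ∀ y x S, qr (mji y x) S = pji y (mmi x S)
  ν : TZ.X → Pl.X
  νr : TZr.X → Pr.X
  hν : IsCLMap ν ∧ Function.Bijective ν ∧
    ∀ x S ζ, ν (mZ (mmi x S) ζ) = pij x (Zj.lactL S ζ)
  hνr : IsCLMap νr ∧ Function.Bijective νr ∧
    ∀ y S ζ, νr (mZr (mmj y S) ζ) = pji y (Zi.lactL S ζ)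
  Θ : Pl.X → Pr.X
  hΘ : IsCLMap Θ ∧ ∀ u S, Θ (q u S) = qr (θij u) S
  hR : ∀ z, νr (R z) = Θ (ν z)

section ClosedSpans

variable {E F : Type*} [NormedAddCommGroup E] [NormedSpace ℂ E]
  [NormedAddCommGroup F] [NormedSpace ℂ F]

/-- The closed linear span of a set of vectors. -/
abbrev closedSpan (S : Set E) : Submodule ℂ E := (Submodule.span ℂ S).topologicalClosure

theorem closedSpan_le {S : Set E} {N : Submodule ℂ E} (hN : IsClosed (N : Set E))
    (h : ∀ x ∈ S, x ∈ N) : closedSpan S ≤ N :=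
  Submodule.topologicalClosure_minimal _ (Submodule.span_le.2 h) hN

theorem subset_closedSpan {S : Set E} {x : E} (hx : x ∈ S) : x ∈ closedSpan S :=
  subset_closure (Submodule.subset_span hx)

theorem isClosed_closedSpan (S : Set E) : IsClosed (closedSpan S : Set E) :=
  Submodule.isClosed_topologicalClosure _

theorem closedSpan_map_mem {S : Set E} {N : Submodule ℂ F} (hN : IsClosed (N : Set F))
    (L : E →L[ℂ] F) (h : ∀ x ∈ S, L x ∈ N) {x : E} (hx : x ∈ closedSpan S) : L x ∈ N :=
  closedSpan_le (N := N.comap (L : E →ₗ[ℂ] F)) (hN.preimage L.continuous) h hx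

theorem closedSpan_ext {S : Set E} {L M : E →L[ℂ] F} (h : ∀ x ∈ S, L x = M x)
    {x : E} (hx : x ∈ closedSpan S) : L x = M x := by
  have := closedSpan_map_mem (N := ⊥) (by simp) (L - M)
    (by intro y hy; simp [h y hy]) hx
  simpa [sub_eq_zero] using this

theorem closedSpan_eq_top {S : Set E} (h : closure (Submodule.span ℂ S : Set E) = Set.univ)
    (x : E) : x ∈ closedSpan S := by
  change x ∈ closure (Submodule.span ℂ S : Set E)
  simp [h]

theorem exists_sum_of_mem_span {ι : Type*} {κ : Type*} (g : ι → κ → E)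
    (hg : ∀ (c : ℂ) i j, ∃ i', g i' j = c • g i j) {x : E}
    (hx : x ∈ Submodule.span ℂ {z | ∃ i j, z = g i j}) :
    ∃ (n : ℕ) (p : Fin n → ι) (q : Fin n → κ), x = ∑ r, g (p r) (q r) := by
  induction hx using Submodule.span_induction with
  | mem x h =>
    obtain ⟨i, j, rfl⟩ := h
    exact ⟨1, fun _ => i, fun _ => j, by simp⟩
  | zero => exact ⟨0, Fin.elim0, Fin.elim0, by simp⟩
  | add x y _ _ h1 h2 =>
    obtain ⟨n, p, q, rfl⟩ := h1
    obtain ⟨m, p', q', rfl⟩ := h2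
    exact ⟨n + m, Fin.append p p', Fin.append q q', by simp [Fin.sum_univ_add]⟩
  | smul c x _ h =>
    obtain ⟨n, p, q, rfl⟩ := h
    choose f hf using hg c
    exact ⟨n, fun r => f (p r) (q r), q, by simp [hf, Finset.smul_sum]⟩

end ClosedSpans

section StarHoms

/-- A map satisfying `IsStarHom`, bundled. -/
def IsStarHom.bundle {π : A → B} (h : IsStarHom π) : A →⋆ₙₐ[ℂ] B where
  toFun := π
  map_smul' := h.map_smul
  map_zero' := by simpa using h.map_smul 0 0
  map_add' := h.map_add
  map_mul' := h.map_mul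
  map_star' := h.map_star

theorem IsStarHom.of_bundle (f : A →⋆ₙₐ[ℂ] B) : IsStarHom f :=
  ⟨_root_.map_add f, _root_.map_mul f, StarHomClass.map_star f, fun c a => _root_.map_smul f c a⟩

theorem IsStarHom.comp {D : Type u} [NonUnitalCStarAlgebra D] {ρ : B → D} {π : A → B}
    (hρ : IsStarHom ρ) (hπ : IsStarHom π) : IsStarHom fun a => ρ (π a) :=
  IsStarHom.of_bundle (hρ.bundle.comp hπ.bundle)

theorem IsStarHom.map_sub {π : A → B} (h : IsStarHom π) (a b : A) : π (a - b) = π a - π b :=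
  _root_.map_sub h.bundle a b

theorem IsStarHom.map_sum {π : A → B} (h : IsStarHom π) {ι : Type*} (s : Finset ι) (f : ι → A) :
    π (∑ i ∈ s, f i) = ∑ i ∈ s, π (f i) :=
  _root_.map_sum h.bundle f s

theorem IsStarHom.norm_le {π : A → B} (h : IsStarHom π) (a : A) : ‖π a‖ ≤ ‖a‖ :=
  NonUnitalStarAlgHom.norm_apply_le h.bundle a

theorem IsStarHom.norm_eq {π : A → B} (h : IsStarHom π) (hi : Function.Injective π) (a : A) :
    ‖π a‖ = ‖a‖ :=
  NonUnitalStarAlgHom.norm_map h.bundle hi a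

/-- A map satisfying `IsStarHom`, as a continuous linear map. -/
def IsStarHom.clm {π : A → B} (h : IsStarHom π) : A →L[ℂ] B :=
  LinearMap.mkContinuous ⟨⟨π, h.map_add⟩, h.map_smul⟩ 1 (by simpa using h.norm_le)

@[simp]
theorem IsStarHom.clm_apply {π : A → B} (h : IsStarHom π) (a : A) : h.clm a = π a := rfl

theorem IsStarHom.continuous {π : A → B} (h : IsStarHom π) : Continuous π := h.clm.continuous

theorem exists_isIncreasingApproximateUnit (A : Type u) [NonUnitalCStarAlgebra A] :
    ∃ l : Filter A, l.NeBot ∧ (∀ a, Tendsto (a * ·) l (𝓝 a)) ∧ (∀ a, Tendsto (· * a) l (𝓝 a)) ∧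
      ∀ᶠ e in l, ‖e‖ ≤ 1 := by
  let _ := CStarAlgebra.spectralOrder A
  let _ := CStarAlgebra.spectralOrderedRing A
  have h := CStarAlgebra.increasingApproximateUnit A
  exact ⟨_, h.neBot, h.tendsto_mul_left, h.tendsto_mul_right, h.eventually_norm⟩

end StarHoms

section Correspondences

variable (W : Corr A)

namespace Corr

theorem inner_add_left (x y z : W.X) : W.inner (x + y) z = W.inner x z + W.inner y z := by
  rw [← W.inner_star, W.inner_add_right, star_add, W.inner_star, W.inner_star]

theorem inner_smul_left (c : ℂ) (x y : W.X) : W.inner (c • x) y = star c • W.inner x y := by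
  rw [← W.inner_star, W.inner_smul_right, star_smul, W.inner_star]

theorem inner_ract_left (x y : W.X) (a : A) : W.inner (W.ract x a) y = star a * W.inner x y := by
  rw [← W.inner_star, W.inner_ract_right, star_mul, W.inner_star]

theorem inner_sub_left (x y z : W.X) : W.inner (x - y) z = W.inner x z - W.inner y z := by
  rw [eq_sub_iff_add_eq, ← W.inner_add_left, sub_add_cancel]

theorem inner_sub_right (x y z : W.X) : W.inner x (y - z) = W.inner x y - W.inner x z := by
  rw [eq_sub_iff_add_eq, ← W.inner_add_right, sub_add_cancel]

theorem inner_zero_right (x : W.X) : W.inner x 0 = 0 := by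
  simpa using W.inner_smul_right 0 x 0

theorem inner_zero_left (x : W.X) : W.inner 0 x = 0 := by
  simpa using W.inner_smul_left 0 0 x

/-- The Cauchy–Schwarz inequality for the `A`-valued inner product. -/
def CauchySchwarz : Prop := ∀ x y : W.X, ‖W.inner x y‖ ≤ ‖x‖ * ‖y‖

/-- The operators `k` and `k'` are adjoint to each other. -/
def AdjointPair (k k' : W.X →L[ℂ] W.X) : Prop :=
  ∀ x y, W.inner (k x) y = W.inner x (k' y)

variable {W}

theorem AdjointPair.symm {k k' : W.X →L[ℂ] W.X} (h : W.AdjointPair k k') :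
    W.AdjointPair k' k := by
  intro x y
  rw [← W.inner_star, ← h, W.inner_star]

theorem AdjointPair.sub {k k' l l' : W.X →L[ℂ] W.X} (h : W.AdjointPair k k')
    (h' : W.AdjointPair l l') : W.AdjointPair (k - l) (k' - l') := by
  intro x y
  simp [W.inner_sub_left, W.inner_sub_right, h x y, h' x y]

theorem AdjointPair.sum {ι : Type*} (s : Finset ι) {k k' : ι → W.X →L[ℂ] W.X}
    (h : ∀ i, W.AdjointPair (k i) (k' i)) :
    W.AdjointPair (∑ i ∈ s, k i) (∑ i ∈ s, k' i) := by
  classical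
  induction s using Finset.induction_on with
  | empty => intro x y; simp [W.inner_zero_left, W.inner_zero_right]
  | insert i s hi ih =>
    intro x y
    rw [Finset.sum_insert hi, Finset.sum_insert hi, _root_.add_apply,
      _root_.add_apply, W.inner_add_left, W.inner_add_right, h i x y, ih x y]

theorem adjointPair_lactL (a : A) : W.AdjointPair (W.lactL a) (W.lactL (star a)) :=
  W.lact_adjoint a

theorem adjointPair_rankOne (x y : W.X) : W.AdjointPair (W.rankOne x y) (W.rankOne y x) := by
  intro z w
  rw [W.rankOne_apply, W.rankOne_apply, W.inner_ract_left, W.inner_ract_right, W.inner_star]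

theorem AdjointPair.norm_le {k k' : W.X →L[ℂ] W.X} (h : W.AdjointPair k k')
    (hW : W.CauchySchwarz) : ‖k'‖ ≤ ‖k‖ := by
  refine k'.opNorm_le_bound (norm_nonneg _) fun z => ?_
  have h1 : ‖k' z‖ ^ 2 ≤ ‖k‖ * ‖k' z‖ * ‖z‖ := by
    rw [W.norm_eq, ← h]
    exact (hW _ _).trans (mul_le_mul_of_nonneg_right (k.le_opNorm _) (norm_nonneg _))
  rcases (norm_nonneg (k' z)).eq_or_lt with h0 | h0
  · rw [← h0]; positivity
  · nlinarith

/-- The map `y ↦ ⟨x, y⟩` as a continuous linear map. -/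
def CauchySchwarz.innerCLM (hW : W.CauchySchwarz) (x : W.X) : W.X →L[ℂ] A :=
  LinearMap.mkContinuous ⟨⟨W.inner x, W.inner_add_right x⟩, fun c => W.inner_smul_right c x⟩ ‖x‖
    (hW x)

@[simp]
theorem CauchySchwarz.innerCLM_apply (hW : W.CauchySchwarz) (x y : W.X) :
    hW.innerCLM x y = W.inner x y := rfl

theorem tendsto_ract {l : Filter A}
    (hl : ∀ a, Tendsto (a * ·) l (𝓝 a)) (hl1 : ∀ᶠ e in l, ‖e‖ ≤ 1) (x : W.X) :
    Tendsto (fun e => W.ract x e) l (𝓝 x) := by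
  rw [tendsto_iff_norm_sub_tendsto_zero]
  have key : Tendsto (fun e => 2 * ‖W.inner x x * e - W.inner x x‖) l (𝓝 0) := by
    simpa using (tendsto_iff_norm_sub_tendsto_zero.1 (hl (W.inner x x))).const_mul 2
  have hsq : Tendsto (fun e => ‖W.ract x e - x‖ ^ 2) l (𝓝 0) := by
    refine squeeze_zero' (Eventually.of_forall fun e => by positivity) ?_ key
    filter_upwards [hl1] with e he
    set p := W.inner x x
    have h2 : W.inner (W.ract x e - x) (W.ract x e - x) = star e * (p * e - p) - (p * e - p) := by
      rw [W.inner_sub_left, W.inner_sub_right, W.inner_sub_right, W.inner_ract_left,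
        W.inner_ract_left, W.inner_ract_right, mul_sub]
    rw [W.norm_eq, h2]
    refine (norm_sub_le _ _).trans ?_
    have := norm_mul_le (star e) (p * e - p)
    rw [norm_star] at this
    nlinarith [norm_nonneg (p * e - p)]
  have := hsq.sqrt
  simpa using this

end Corr

namespace IsRep

variable {W} {π : A → B} {t : W.X → B}

theorem norm_le (h : IsRep W π t) (x : W.X) : ‖t x‖ ≤ ‖x‖ := by
  refine le_of_sq_le_sq ?_ (norm_nonneg _)
  rw [sq, ← CStarRing.norm_star_mul_self, h.inner, W.norm_eq]
  exact h.hom.norm_le _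

theorem norm_eq (h : IsRep W π t) (hi : Function.Injective π) (x : W.X) : ‖t x‖ = ‖x‖ := by
  refine (sq_eq_sq₀ (norm_nonneg _) (norm_nonneg _)).1 ?_
  rw [sq, ← CStarRing.norm_star_mul_self, h.inner, W.norm_eq, h.hom.norm_eq hi]

/-- The linear part of a representation, as a continuous linear map. -/
def clm (h : IsRep W π t) : W.X →L[ℂ] B :=
  LinearMap.mkContinuous ⟨⟨t, h.t_add⟩, h.t_smul⟩ 1 (by simpa using h.norm_le)

@[simp]
theorem clm_apply (h : IsRep W π t) (x : W.X) : h.clm x = t x := rfl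

theorem continuous (h : IsRep W π t) : Continuous t := h.clm.continuous

theorem map_sub (h : IsRep W π t) (x y : W.X) : t (x - y) = t x - t y :=
  _root_.map_sub h.clm x y

theorem map_sum (h : IsRep W π t) {ι : Type*} (s : Finset ι) (f : ι → W.X) :
    t (∑ i ∈ s, f i) = ∑ i ∈ s, t (f i) :=
  _root_.map_sum h.clm f s

theorem cauchySchwarz (h : IsRep W π t) (hi : Function.Injective π) : W.CauchySchwarz := by
  intro x y
  rw [← h.hom.norm_eq hi, ← h.inner, ← h.norm_eq hi x, ← h.norm_eq hi y, ← norm_star (t x)]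
  exact norm_mul_le _ _

theorem rankOne (h : IsRep W π t) (x y z : W.X) :
    t (W.rankOne x y z) = t x * star (t y) * t z := by
  rw [W.rankOne_apply, h.ract, ← h.inner, mul_assoc]

end IsRep

end Correspondences

section Covariance

/-- If `p ^ n c` grows at most like `q ^ n` for a selfadjoint `p`, then `p` is bounded by `q` on
`c`. -/
theorem norm_mul_le_of_iterate {p c : B} (hp : star p = p) {q K : ℝ}
    (hq : 0 ≤ q) (hK : ∀ n, ‖(p * ·)^[n] c‖ ≤ K * q ^ n) : ‖p * c‖ ≤ q * ‖c‖ := by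
  set a : ℕ → ℝ := fun n => ‖(p * ·)^[n] c‖ with ha
  have hadj : ∀ n x y, star ((p * ·)^[n] x) * y = star x * (p * ·)^[n] y := by
    intro n
    induction n with
    | zero => intro x y; rfl
    | succ n ih =>
      intro x y
      rw [Function.iterate_succ_apply, ih, Function.iterate_succ_apply', star_mul, hp, mul_assoc]
  have hsq : ∀ n, a n ^ 2 ≤ a 0 * a (n + n) := by
    intro n
    simp only [ha]
    rw [sq, ← CStarRing.norm_star_mul_self, hadj, ← Function.iterate_add_apply]
    refine (norm_mul_le _ _).trans ?_
    simp
  have ha0 : ∀ n, 0 ≤ a n := fun n => norm_nonneg _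
  have hpow : ∀ m, a 1 ^ 2 ^ m * a 0 ≤ a 0 ^ 2 ^ m * a (2 ^ m) := by
    intro m
    induction m with
    | zero => simp [mul_comm]
    | succ m ih =>
      rcases (ha0 0).eq_or_lt with h0 | h0
      · rw [← h0]; simp
      · have h1 := pow_le_pow_left₀ (by have := ha0 1; positivity) ih 2
        have h2 := hsq (2 ^ m)
        have h3 : (2 : ℕ) ^ (m + 1) = 2 ^ m + 2 ^ m := by ring
        have h4 : a 0 * (a 1 ^ 2 ^ (m + 1) * a 0) ≤
            a 0 * (a 0 ^ 2 ^ (m + 1) * a (2 ^ (m + 1))) := by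
          calc a 0 * (a 1 ^ 2 ^ (m + 1) * a 0) = (a 1 ^ 2 ^ m * a 0) ^ 2 := by rw [h3]; ring
            _ ≤ (a 0 ^ 2 ^ m * a (2 ^ m)) ^ 2 := h1
            _ = (a 0 ^ 2 ^ m) ^ 2 * a (2 ^ m) ^ 2 := by ring
            _ ≤ (a 0 ^ 2 ^ m) ^ 2 * (a 0 * a (2 ^ m + 2 ^ m)) := by gcongr
            _ = _ := by rw [h3]; ring
        exact le_of_mul_le_mul_left h4 h0
  change a 1 ≤ q * a 0
  by_contra! hlt
  rcases (ha0 0).eq_or_lt with h0 | h0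
  · have h1 : c = 0 := norm_eq_zero.1 h0.symm
    have h2 : a 1 = 0 := by simp [ha, h1]
    rw [h2, ← h0] at hlt
    simp at hlt
  have hbound : ∀ m, a 1 ^ 2 ^ m * a 0 ≤ K * (q * a 0) ^ 2 ^ m := fun m =>
    calc a 1 ^ 2 ^ m * a 0 ≤ a 0 ^ 2 ^ m * a (2 ^ m) := hpow m
      _ ≤ a 0 ^ 2 ^ m * (K * q ^ 2 ^ m) := by gcongr; exact hK _
      _ = _ := by rw [mul_pow]; ring
  rcases (mul_nonneg hq h0.le).eq_or_lt with h5 | h5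
  · have := hbound 0
    rw [← h5] at this
    simp only [pow_zero, pow_one, mul_zero] at this
    nlinarith
  · have h6 : 1 < a 1 / (q * a 0) := (one_lt_div h5).2 hlt
    have h7 : Tendsto (fun m : ℕ => (a 1 / (q * a 0)) ^ 2 ^ m) atTop atTop :=
      (tendsto_pow_atTop_atTop_of_one_lt h6).comp
        (tendsto_pow_atTop_atTop_of_one_lt (one_lt_two : (1 : ℕ) < 2))
    obtain ⟨m, hm⟩ := (h7.eventually_gt_atTop (K / a 0)).exists
    rw [div_pow, div_lt_div_iff₀ h0 (by positivity)] at hm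
    exact (hbound m).not_gt hm

variable {W : Corr A} {π : A → B} {t : W.X → B}

/-- The closed right ideal generated by the image of `t`. -/
abbrev rangeIdeal (t : W.X → B) : Submodule ℂ B := closedSpan {c | ∃ x b, c = t x * b}

/-- The closed span of the elements `t(x) t(y)*`. -/
abbrev compactPart (t : W.X → B) : Submodule ℂ B := closedSpan {c | ∃ x y, c = t x * star (t y)}

theorem star_mem_compactPart {c : B} (hc : c ∈ compactPart t) : star c ∈ compactPart t := by
  have := closedSpan_map_mem (F := B) (N := (compactPart t).comap
    ((starLinearEquiv ℂ : B ≃ₗ⋆[ℂ] B) : B →ₗ⋆[ℂ] B))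
    ((isClosed_closedSpan _).preimage continuous_star) (ContinuousLinearMap.id ℂ B)
    (by
      rintro _ ⟨x, y, rfl⟩
      exact subset_closedSpan ⟨y, x, by simp⟩) hc
  simpa using this

theorem compactPart_le_rangeIdeal : compactPart t ≤ rangeIdeal t :=
  Submodule.topologicalClosure_mono (Submodule.span_mono (by
    rintro _ ⟨x, y, rfl⟩
    exact ⟨x, _, rfl⟩))

theorem IsRep.norm_mul_le (h : IsRep W π t) (hW : W.CauchySchwarz) {d : B}
    {k k' : W.X →L[ℂ] W.X} (hk : W.AdjointPair k k') (hd : ∀ x, d * t x = t (k x))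
    (hd' : ∀ x, star d * t x = t (k' x)) {c : B} (hc : c ∈ rangeIdeal t) :
    ‖d * c‖ ≤ ‖k‖ * ‖c‖ := by
  have hcl : IsClosed {c : B | ‖d * c‖ ≤ ‖k‖ * ‖c‖} :=
    isClosed_le (by fun_prop) (by fun_prop)
  refine closure_minimal (fun c hc => ?_) hcl hc
  set p := star d * d with hpd
  have hp : star p = p := by simp [hpd]
  have hpt : ∀ n x b, (p * ·)^[n] (t x * b) = t ((fun y => k' (k y))^[n] x) * b := by
    intro n
    induction n with
    | zero => intro x b; rfl
    | succ n ih =>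
      intro x b
      rw [Function.iterate_succ_apply', ih, Function.iterate_succ_apply', hpd, mul_assoc,
        ← mul_assoc d, hd, ← mul_assoc, hd']
  have hkn : ∀ n x, ‖(fun y => k' (k y))^[n] x‖ ≤ (‖k‖ ^ 2) ^ n * ‖x‖ := by
    intro n
    induction n with
    | zero => intro x; simp
    | succ n ih =>
      intro x
      rw [Function.iterate_succ_apply']
      calc _ ≤ ‖k‖ * (‖k‖ * ((‖k‖ ^ 2) ^ n * ‖x‖)) :=
            (k'.le_of_opNorm_le (hk.norm_le hW) _).trans
              (by gcongr; exact (k.le_opNorm _).trans (by gcongr; exact ih x))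
        _ = _ := by ring
  have hadd : ∀ n x y, (p * ·)^[n] (x + y) = (p * ·)^[n] x + (p * ·)^[n] y := by
    intro n
    induction n with
    | zero => intro x y; rfl
    | succ n ih => intro x y; simp only [Function.iterate_succ_apply', ih, mul_add]
  have hsmul : ∀ n (s : ℂ) x, (p * ·)^[n] (s • x) = s • (p * ·)^[n] x := by
    intro n
    induction n with
    | zero => intro x y; rfl
    | succ n ih => intro x y; simp only [Function.iterate_succ_apply', ih, mul_smul_comm]
  have hK : ∃ K : ℝ, ∀ n, ‖(p * ·)^[n] c‖ ≤ K * (‖k‖ ^ 2) ^ n := by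
    induction hc using Submodule.span_induction with
    | mem c hc =>
      obtain ⟨x, b, rfl⟩ := hc
      refine ⟨‖x‖ * ‖b‖, fun n => ?_⟩
      rw [hpt]
      calc _ ≤ ‖t ((fun y => k' (k y))^[n] x)‖ * ‖b‖ := _root_.norm_mul_le _ _
        _ ≤ ((‖k‖ ^ 2) ^ n * ‖x‖) * ‖b‖ := by
          gcongr
          exact (h.norm_le _).trans (hkn n x)
        _ = _ := by ring
    | zero =>
      refine ⟨0, fun n => ?_⟩
      have := hsmul n 0 0
      simp only [zero_smul] at this
      simp [this]
    | add x y _ _ hx hy =>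
      obtain ⟨K, hK⟩ := hx
      obtain ⟨L, hL⟩ := hy
      refine ⟨K + L, fun n => ?_⟩
      rw [hadd, add_mul]
      exact (norm_add_le _ _).trans (add_le_add (hK n) (hL n))
    | smul s x _ hx =>
      obtain ⟨K, hK⟩ := hx
      refine ⟨‖s‖ * K, fun n => ?_⟩
      rw [hsmul, norm_smul, mul_assoc]
      exact mul_le_mul_of_nonneg_left (hK n) (norm_nonneg _)
  obtain ⟨K, hK⟩ := hK
  have h1 := norm_mul_le_of_iterate hp (by positivity) hK
  have h2 : ‖d * c‖ ^ 2 ≤ (‖k‖ * ‖c‖) ^ 2 := by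
    rw [sq, ← CStarRing.norm_star_mul_self, star_mul, mul_assoc, ← mul_assoc (star d)]
    refine (_root_.norm_mul_le _ _).trans ?_
    rw [norm_star]
    nlinarith [norm_nonneg c]
  exact le_of_sq_le_sq h2 (by positivity)

/-- The difference of `φ(a)` and a sum of rank-one operators, against its counterpart in `B`. -/
theorem IsRep.norm_sub_sum_mul_le (h : IsRep W π t) (hW : W.CauchySchwarz) (a : A) {n : ℕ}
    (x y : Fin n → W.X) {c : B} (hc : c ∈ rangeIdeal t) :
    ‖(π a - ∑ r, t (x r) * star (t (y r))) * c‖ ≤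
      ‖W.lactL a - ∑ r, W.rankOne (x r) (y r)‖ * ‖c‖ := by
  refine h.norm_mul_le hW ((Corr.adjointPair_lactL a).sub
    (Corr.AdjointPair.sum _ fun r => Corr.adjointPair_rankOne (x r) (y r))) (fun z => ?_)
    (fun z => ?_) hc
  · simp [sub_mul, Finset.sum_mul, h.map_sub, h.map_sum, h.lact, h.rankOne, sum_apply]
  · simp [sub_mul, Finset.sum_mul, h.map_sub, h.map_sum, h.lact, h.rankOne, h.hom.map_star,
      sum_apply]

/-- A representation for which `π(A)` lies in the closed span of `t(X) t(X)*` is covariant. -/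
theorem IsRep.cpCov (h : IsRep W π t) (hW : W.CauchySchwarz) (hM : ∀ a, π a ∈ compactPart t) :
    CPCov W π t := by
  intro a N x y hxy
  rw [tendsto_iff_norm_sub_tendsto_zero] at hxy ⊢
  refine squeeze_zero (fun n => norm_nonneg _) (fun n => ?_) hxy
  rw [norm_sub_rev, norm_sub_rev _ (W.lactL a)]
  set d := π a - ∑ r, t (x n r) * star (t (y n r)) with hd
  have hdM : d ∈ compactPart t :=
    sub_mem (hM a) (sum_mem fun r _ => subset_closedSpan ⟨_, _, rfl⟩)
  have h1 := h.norm_sub_sum_mul_le hW a (x n) (y n)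
    (compactPart_le_rangeIdeal (star_mem_compactPart hdM))
  rw [← hd, CStarRing.norm_self_mul_star, norm_star] at h1
  rcases (norm_nonneg d).eq_or_lt with h0 | h0
  · rw [← h0]; exact norm_nonneg _
  · exact le_of_mul_le_mul_right h1 h0

/-- Regularity provides sequences of finite rank operators approximating the left action. -/
theorem Corr.Regular.exists_tendsto (hW : W.Regular) (a : A) :
    ∃ (N : ℕ → ℕ) (x y : ∀ n, Fin (N n) → W.X),
      Tendsto (fun n => ∑ r, W.rankOne (x n r) (y n r)) atTop (𝓝 (W.lactL a)) := by
  obtain ⟨T, hT, hlim⟩ := mem_closure_iff_seq_limit.1 (hW.2 a)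
  have hsmul : ∀ (c : ℂ) x y, W.rankOne (c • x) y = c • W.rankOne x y := by
    intro c x y
    ext z
    simp [W.rankOne_apply, W.ract_smul]
  choose N x y hxy using fun n => exists_sum_of_mem_span W.rankOne
    (fun c x y => ⟨c • x, hsmul c x y⟩) (hT n)
  exact ⟨N, x, y, by simpa only [← hxy] using hlim⟩

theorem CPCov.mem_compactPart (h : CPCov W π t) (hW : W.Regular) (a : A) :
    π a ∈ compactPart t := by
  obtain ⟨N, x, y, hxy⟩ := hW.exists_tendsto a
  exact (isClosed_closedSpan _).mem_of_tendsto (h a N x y hxy)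
    (Eventually.of_forall fun n => sum_mem fun r _ => subset_closedSpan ⟨_, _, rfl⟩)

end Covariance

section Extension

variable {W : Corr A} {π : A → B}

/-- A family in a C*-algebra with the same inner products as a total family in a Hilbert module
extends to a representation. -/
theorem exists_isRep_of_inner (hW : W.CauchySchwarz) (hπ : IsStarHom π) {ι : Type u}
    (g : ι → W.X) (f : ι → B)
    (hg : ∀ x, x ∈ closedSpan (Set.range g))
    (hinner : ∀ i j, star (f i) * f j = π (W.inner (g i) (g j)))
    (hlact : ∀ t : W.X →L[ℂ] B, (∀ i, t (g i) = f i) →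
      (∀ x y, star (t x) * t y = π (W.inner x y)) → ∀ a i, t (W.lactL a (g i)) = π a * f i) :
    ∃ t : W.X → B, IsRep W π t ∧ ∀ i, t (g i) = f i := by
  classical
  let e : (ι →₀ ℂ) →ₗ[ℂ] W.X := Finsupp.linearCombination ℂ g
  let F : (ι →₀ ℂ) →ₗ[ℂ] B := Finsupp.linearCombination ℂ f
  have hspan : (LinearMap.range e) = Submodule.span ℂ (Set.range g) :=
    Finsupp.range_linearCombination ℂ
  have hdense : DenseRange e := by
    intro x
    have h := hg x
    have hs : Set.range e = (LinearMap.range e : Set W.X) := rfl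
    rw [hs, hspan]
    exact h
  have hin : ∀ u v, star (F u) * F v = π (W.inner (e u) (e v)) := by
    intro u v
    induction u using Finsupp.induction_linear with
    | zero => simp [W.inner_zero_left, show π 0 = 0 from map_zero hπ.bundle]
    | add u u' h h' => simp only [map_add, star_add, add_mul, h, h', W.inner_add_left, hπ.map_add]
    | single i c =>
      induction v using Finsupp.induction_linear with
      | zero => simp [W.inner_zero_right, show π 0 = 0 from map_zero hπ.bundle]
      | add u u' h h' => simp only [map_add, mul_add, h, h', W.inner_add_right, hπ.map_add]
      | single j d =>
        simp [F, e, Finsupp.linearCombination_single, W.inner_smul_left, W.inner_smul_right,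
          hπ.map_smul, hinner, smul_mul_assoc, mul_smul_comm, smul_comm d]
  have hnorm : ∀ u, ‖F u‖ ≤ 1 * ‖e u‖ := by
    intro u
    rw [one_mul]
    refine le_of_sq_le_sq ?_ (norm_nonneg _)
    rw [sq, ← CStarRing.norm_star_mul_self, hin, W.norm_eq]
    exact hπ.norm_le _
  let t : W.X →L[ℂ] B := F.extendOfNorm e
  have hte : ∀ u, t (e u) = F u := F.extendOfNorm_eq hdense ⟨1, hnorm⟩
  have htg : ∀ i, t (g i) = f i := by
    intro i
    simpa [e, F, Finsupp.linearCombination_single] using hte (Finsupp.single i 1)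
  have hTin : ∀ x y, star (t x) * t y = π (W.inner x y) := by
    have step : ∀ x, (∀ i, star (t x) * f i = π (W.inner x (g i))) →
        ∀ y, star (t x) * t y = π (W.inner x y) := by
      intro x hx y
      refine closedSpan_ext (L := (ContinuousLinearMap.mul ℂ B (star (t x))).comp t)
        (M := hπ.clm.comp (hW.innerCLM x)) ?_ (hg y)
      rintro _ ⟨i, rfl⟩
      simp [htg, hx]
    have h1 : ∀ i y, star (f i) * t y = π (W.inner (g i) y) := by
      intro i
      rw [← htg]
      exact step _ fun j => by rw [htg, hinner]
    intro x
    refine step x fun i => ?_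
    rw [← W.inner_star, hπ.map_star, ← h1, star_mul, star_star]
  have hract : ∀ x a, t (W.ract x a) = t x * π a := by
    intro x a
    rw [← sub_eq_zero, ← CStarRing.star_mul_self_eq_zero_iff]
    simp only [star_sub, sub_mul, mul_sub, star_mul, hTin, mul_assoc, W.inner_ract_left,
      W.inner_ract_right, hπ.map_mul, hπ.map_star]
    simp only [← mul_assoc (star (t _)), hTin, W.inner_ract_left, hπ.map_mul, hπ.map_star,
      mul_assoc]
    abel
  refine ⟨t, ⟨hπ, map_add t, fun c x => map_smul t c x, fun a x => ?_, hract, hTin⟩, htg⟩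
  refine closedSpan_ext (L := t.comp (W.lactL a)) (M := (ContinuousLinearMap.mul ℂ B (π a)).comp t)
    ?_ (hg x)
  rintro _ ⟨i, rfl⟩
  simp [hlact t htg hTin, htg]

end Extension

section Tensor

variable {W V T : Corr A} {m : W.X → V.X → T.X} {π : A → B} {f : W.X → B} {g : V.X → B}

theorem IsTensor.mem_closedSpan (h : IsTensor W V T m) (z : T.X) :
    z ∈ closedSpan (Set.range fun p : W.X × V.X => m p.1 p.2) := by
  have hs : (Set.range fun p : W.X × V.X => m p.1 p.2) = {z | ∃ x y, z = m x y} := by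
    ext z
    simp [eq_comm]
  rw [hs]
  exact closedSpan_eq_top h.dense z

theorem IsTensor.exists_isRep (h : IsTensor W V T m) (hT : T.CauchySchwarz)
    (hf : IsRep W π f) (hg : IsRep V π g) :
    ∃ t : T.X → B, IsRep T π t ∧ ∀ x y, t (m x y) = f x * g y := by
  obtain ⟨t, ht, htm⟩ := exists_isRep_of_inner hT hf.hom (fun p : W.X × V.X => m p.1 p.2)
    (fun p => f p.1 * g p.2) h.mem_closedSpan
    (by
      rintro ⟨x, y⟩ ⟨x', y'⟩
      simp only [star_mul, h.inner, ← hg.inner, hg.lact, ← hf.inner, mul_assoc])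
    (by
      rintro t ht - a ⟨x, y⟩
      have := ht (W.lactL a x, y)
      simp only [hf.lact] at this
      rw [h.lact, this, mul_assoc])
  exact ⟨t, ht, fun x y => htm (x, y)⟩

/-- Representations of a tensor product agreeing on elementary tensors are equal. -/
theorem IsTensor.rep_ext (h : IsTensor W V T m) {t t' : T.X →L[ℂ] B}
    (htt : ∀ x y, t (m x y) = t' (m x y)) (z : T.X) : t z = t' z :=
  closedSpan_ext (by rintro _ ⟨p, rfl⟩; exact htt _ _) (h.mem_closedSpan z)

theorem IsRep.tendsto_mul {t : W.X → B} (ht : IsRep W π t) {l : Filter A}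
    (hl : ∀ a, Tendsto (a * ·) l (𝓝 a)) (hl1 : ∀ᶠ e in l, ‖e‖ ≤ 1) (x : W.X) :
    Tendsto (fun e => t x * π e) l (𝓝 (t x)) := by
  simp only [← ht.ract]
  exact (ht.continuous.tendsto x).comp (W.tendsto_ract hl hl1 x)

/-- An element `t(x) c` lies in the closed subspace `N` as soon as all `t(x) π(a) c` do. -/
theorem IsRep.mem_of_forall_mul {t : W.X → B} (ht : IsRep W π t) {N : Submodule ℂ B}
    (hN : IsClosed (N : Set B)) (x : W.X) (c : B) (h : ∀ a, t x * π a * c ∈ N) :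
    t x * c ∈ N := by
  obtain ⟨l, hl0, hl, -, hl1⟩ := exists_isIncreasingApproximateUnit A
  exact hN.mem_of_tendsto ((ht.tendsto_mul hl hl1 x).mul_const c) (Eventually.of_forall h)

theorem IsRep.mem_of_forall_mul' {t : W.X → B} (ht : IsRep W π t) {N : Submodule ℂ B}
    (hN : IsClosed (N : Set B)) (x : W.X) (h : ∀ a, t x * π a ∈ N) : t x ∈ N := by
  obtain ⟨l, hl0, hl, -, hl1⟩ := exists_isIncreasingApproximateUnit A
  exact hN.mem_of_tendsto (ht.tendsto_mul hl hl1 x) (Eventually.of_forall h)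

theorem compactPart_mul (hf : IsRep W π f)
    (hfM : ∀ a, π a ∈ compactPart f) (hgM : ∀ a, π a ∈ compactPart g) {t : T.X → B}
    (ht : ∀ x y, t (m x y) = f x * g y) (a : A) : π a ∈ compactPart t := by
  refine closedSpan_le (isClosed_closedSpan _) ?_ (hfM a)
  rintro _ ⟨x, x', rfl⟩
  refine hf.mem_of_forall_mul (isClosed_closedSpan _) x _ fun b => ?_
  refine closedSpan_map_mem (isClosed_closedSpan _)
    (((ContinuousLinearMap.mul ℂ B).flip (star (f x'))).comp (ContinuousLinearMap.mul ℂ B (f x)))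
    ?_ (hgM b)
  rintro _ ⟨y, y', rfl⟩
  refine subset_closedSpan ⟨m x y, m x' y', ?_⟩
  simp [ht, mul_assoc]

end Tensor

section FiberRepresentations

variable {k : ℕ} {Xs : PSys A k} {D : Type u} [NonUnitalCStarAlgebra D]

theorem PSRep.apply_heq (r : PSRep Xs B) {s s' : Fin k → ℕ} (hs : s = s') {x : (Xs.fib s).X}
    {x' : (Xs.fib s').X} (hx : HEq x x') : r.ψ s x = r.ψ s' x' := by
  subst hs
  rw [eq_of_heq hx]

theorem PSRep.norm_mul_le {r : PSRep Xs D} (hr : Function.Injective r.π) {s t : Fin k → ℕ}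
    (x : (Xs.fib s).X) (y : (Xs.fib t).X) : ‖Xs.mul s t x y‖ ≤ ‖x‖ * ‖y‖ := by
  rw [← (r.isRep _).norm_eq hr, ← (r.isRep _).norm_eq hr, ← (r.isRep t).norm_eq hr, ← r.mul]
  exact _root_.norm_mul_le _ _

/-- Multiplication by `y` on the right, as a continuous linear map between fibers. -/
def PSRep.mulRight {r : PSRep Xs D} (hr : Function.Injective r.π) (s : Fin k → ℕ)
    {t : Fin k → ℕ} (y : (Xs.fib t).X) : (Xs.fib s).X →L[ℂ] (Xs.fib (s + t)).X :=
  LinearMap.mkContinuous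
    ⟨⟨fun x => Xs.mul s t x y, fun x x' => (Xs.isTensor s t).add_left x x' y⟩,
      fun c x => (Xs.isTensor s t).smul_left c x y⟩ ‖y‖
    fun x => (PSRep.norm_mul_le hr x y).trans_eq (mul_comm _ _)

theorem PSRep.triple_mem_closedSpan {r : PSRep Xs D} (hr : Function.Injective r.π)
    (s t u : Fin k → ℕ) (w : (Xs.fib (s + t + u)).X) :
    w ∈ closedSpan (Set.range fun p : (Xs.fib s).X × (Xs.fib t).X × (Xs.fib u).X =>
      Xs.mul (s + t) u (Xs.mul s t p.1 p.2.1) p.2.2) := by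
  refine closedSpan_le (isClosed_closedSpan _) ?_ ((Xs.isTensor (s + t) u).mem_closedSpan w)
  rintro _ ⟨⟨v, z⟩, rfl⟩
  refine closedSpan_map_mem (isClosed_closedSpan _) (PSRep.mulRight hr (s + t) z) ?_
    ((Xs.isTensor s t).mem_closedSpan v)
  rintro _ ⟨⟨x, y⟩, rfl⟩
  exact subset_closedSpan ⟨(x, y, z), rfl⟩

/-- Representations of single fibers of `Xs`, extending `π : A → B`, with `π(A)` contained in the
closed span of `ψ(X_s) ψ(X_s)*`. -/
def FibRep {π : A → B} (_hπ : IsStarHom π) {r : PSRep Xs D} (_hr : Function.Injective r.π) :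
    Type u :=
  {p : Σ s, ((Xs.fib s).X → B) // IsRep (Xs.fib p.1) π p.2 ∧ ∀ a, π a ∈ compactPart p.2}

namespace FibRep

variable {π : A → B} {hπ : IsStarHom π} {r : PSRep Xs D} {hr : Function.Injective r.π}

/-- The index of the fiber that is represented. -/
def deg (p : FibRep hπ hr) : Fin k → ℕ := p.1.1

/-- The representation as a map, with its index `s` prescribed. -/
def rep (p : FibRep hπ hr) (s : Fin k → ℕ) (h : p.deg = s) : (Xs.fib s).X → B := h ▸ p.1.2

theorem isRep_at (p : FibRep hπ hr) (s : Fin k → ℕ) (h : p.deg = s) :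
    IsRep (Xs.fib s) π (p.rep s h) := by
  subst h
  exact p.2.1

theorem mem_compactPart_at (p : FibRep hπ hr) (s : Fin k → ℕ) (h : p.deg = s) (a : A) :
    π a ∈ compactPart (p.rep s h) := by
  subst h
  exact p.2.2 a

theorem rep_congr {p q : FibRep hπ hr} (hpq : p = q) {s : Fin k → ℕ} (hp : p.deg = s)
    (hq : q.deg = s) (x : (Xs.fib s).X) : p.rep s hp x = q.rep s hq x := by
  subst hpq
  rfl

/-- The fiber representation determined by a map on the fiber over `s`. -/
def mk (s : Fin k → ℕ) (f : (Xs.fib s).X → B) (hf : IsRep (Xs.fib s) π f)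
    (hM : ∀ a, π a ∈ compactPart f) : FibRep hπ hr :=
  ⟨⟨s, f⟩, hf, hM⟩

theorem ext_of_total {p q : FibRep hπ hr} {s s' : Fin k → ℕ} (hp : p.deg = s) (hq : q.deg = s')
    (hs : s = s')
    {ι : Type u} (g : ι → (Xs.fib s).X) (g' : ι → (Xs.fib s').X)
    (hg : ∀ x, x ∈ closedSpan (Set.range g)) (hgg : ∀ i, HEq (g i) (g' i))
    (h : ∀ i, p.rep s hp (g i) = q.rep s' hq (g' i)) : p = q := by
  obtain ⟨⟨s₁, f⟩, hf, hM⟩ := p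
  obtain ⟨⟨s₂, f'⟩, hf', hM'⟩ := q
  change s₁ = s at hp
  change s₂ = s' at hq
  subst hp hs hq
  have : f = f' := by
    funext x
    refine closedSpan_ext (L := hf.clm) (M := hf'.clm) ?_ (hg x)
    rintro _ ⟨i, rfl⟩
    have := h i
    rw [← eq_of_heq (hgg i)] at this
    exact this
  subst this
  rfl

theorem exists_one (hπ : IsStarHom π) : ∃ f : (Xs.fib 0).X → B,
    IsRep (Xs.fib 0) π f ∧ (∀ a, π a ∈ compactPart f) ∧ ∀ a, f (Xs.unit a) = π a := by
  obtain ⟨f, hf⟩ : ∃ f : (Xs.fib 0).X → B, ∀ a, f (Xs.unit a) = π a :=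
    ⟨fun x => π ((Equiv.ofBijective _ Xs.unit_bij).symm x), fun a =>
      congrArg π ((Equiv.ofBijective _ Xs.unit_bij).symm_apply_apply a)⟩
  refine ⟨f, ⟨hπ, ?_, ?_, ?_, ?_, ?_⟩, fun a => ?_, hf⟩
  · intro x y
    obtain ⟨a, rfl⟩ := Xs.unit_bij.2 x
    obtain ⟨b, rfl⟩ := Xs.unit_bij.2 y
    rw [← Xs.unit_add, hf, hf, hf, hπ.map_add]
  · intro c x
    obtain ⟨a, rfl⟩ := Xs.unit_bij.2 x
    rw [← Xs.unit_smul, hf, hf, hπ.map_smul]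
  · intro a x
    obtain ⟨b, rfl⟩ := Xs.unit_bij.2 x
    rw [Xs.unit_lact, hf, hf, hπ.map_mul]
  · intro x a
    obtain ⟨b, rfl⟩ := Xs.unit_bij.2 x
    rw [Xs.unit_ract, hf, hf, hπ.map_mul]
  · intro x y
    obtain ⟨a, rfl⟩ := Xs.unit_bij.2 x
    obtain ⟨b, rfl⟩ := Xs.unit_bij.2 y
    rw [Xs.unit_inner, hf, hf, hπ.map_mul, hπ.map_star]
  · obtain ⟨l, hl0, hl, -⟩ := exists_isIncreasingApproximateUnit A
    refine (isClosed_closedSpan _).mem_of_tendsto ((hπ.continuous.tendsto a).comp (hl a))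
      (Eventually.of_forall fun e => ?_)
    refine subset_closedSpan ⟨Xs.unit a, Xs.unit (star e), ?_⟩
    simp [hf, hπ.map_mul, hπ.map_star]

instance : One (FibRep hπ hr) :=
  ⟨mk 0 (exists_one hπ).choose (exists_one hπ).choose_spec.1 (exists_one hπ).choose_spec.2.1⟩

theorem deg_one : (1 : FibRep hπ hr).deg = 0 := rfl

theorem one_rep_unit (a : A) : (1 : FibRep hπ hr).rep 0 deg_one (Xs.unit a) = π a :=
  (exists_one (Xs := Xs) hπ).choose_spec.2.2 a

theorem exists_mul (p q : FibRep hπ hr) : ∃ f : (Xs.fib (p.deg + q.deg)).X → B,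
    IsRep (Xs.fib (p.deg + q.deg)) π f ∧ (∀ a, π a ∈ compactPart f) ∧
      ∀ x y, f (Xs.mul p.deg q.deg x y) = p.rep _ rfl x * q.rep _ rfl y := by
  obtain ⟨f, hf, hfm⟩ := (Xs.isTensor p.deg q.deg).exists_isRep
    ((r.isRep _).cauchySchwarz hr) (p.isRep_at _ rfl) (q.isRep_at _ rfl)
  exact ⟨f, hf, compactPart_mul (p.isRep_at _ rfl) (p.mem_compactPart_at _ rfl)
    (q.mem_compactPart_at _ rfl) hfm, hfm⟩

instance : Mul (FibRep hπ hr) :=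
  ⟨fun p q => mk _ (exists_mul p q).choose (exists_mul p q).choose_spec.1
    (exists_mul p q).choose_spec.2.1⟩

theorem deg_mul (p q : FibRep hπ hr) : (p * q).deg = p.deg + q.deg := rfl

theorem mul_rep {p q : FibRep hπ hr} {s t : Fin k → ℕ} (hp : p.deg = s) (hq : q.deg = t)
    (h : (p * q).deg = s + t) (x : (Xs.fib s).X) (y : (Xs.fib t).X) :
    (p * q).rep (s + t) h (Xs.mul s t x y) = p.rep s hp x * q.rep t hq y := by
  subst hp hq
  exact (exists_mul p q).choose_spec.2.2 x y

instance : Monoid (FibRep hπ hr) where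
  mul_assoc p q v := by
    refine ext_of_total rfl rfl (add_assoc p.deg q.deg v.deg) _
      (fun x : (Xs.fib p.deg).X × (Xs.fib q.deg).X × (Xs.fib v.deg).X =>
        Xs.mul p.deg (q.deg + v.deg) x.1 (Xs.mul q.deg v.deg x.2.1 x.2.2))
      (PSRep.triple_mem_closedSpan hr p.deg q.deg v.deg)
      (fun _ => Xs.assoc _ _ _ _ _ _) ?_
    rintro ⟨x, y, z⟩
    have h1 := mul_rep (p := p * q) (q := v) rfl rfl rfl (Xs.mul p.deg q.deg x y) z
    have h2 := mul_rep (p := p) (q := q * v) rfl rfl rfl x (Xs.mul q.deg v.deg y z)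
    have h3 := mul_rep (p := p) (q := q) rfl rfl rfl x y
    have h4 := mul_rep (p := q) (q := v) rfl rfl rfl y z
    exact (h1.trans (congrArg (· * _) h3)).trans
      ((mul_assoc _ _ _).trans (h2.trans (congrArg (_ * ·) h4)).symm)
  one_mul p := by
    refine ext_of_total rfl rfl (zero_add p.deg) _
      (fun x : A × (Xs.fib p.deg).X => (Xs.fib p.deg).lactL x.1 x.2) (fun x => ?_)
      (fun x => Xs.unit_mul_left _ _ _) ?_
    · refine closedSpan_le (isClosed_closedSpan _) ?_ ((Xs.isTensor 0 p.deg).mem_closedSpan x)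
      rintro _ ⟨⟨u, y⟩, rfl⟩
      obtain ⟨a, rfl⟩ := Xs.unit_bij.2 u
      exact subset_closedSpan ⟨(a, y), rfl⟩
    · rintro ⟨a, y⟩
      refine (mul_rep (p := 1) (q := p) rfl rfl rfl (Xs.unit a) y).trans ?_
      exact (congrArg (· * _) (one_rep_unit a)).trans ((p.isRep_at _ rfl).lact a y).symm
  mul_one p := by
    refine ext_of_total rfl rfl (add_zero p.deg) _
      (fun x : (Xs.fib p.deg).X × A => (Xs.fib p.deg).ract x.1 x.2) (fun x => ?_)
      (fun x => Xs.unit_mul_right _ _ _) ?_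
    · refine closedSpan_le (isClosed_closedSpan _) ?_ ((Xs.isTensor p.deg 0).mem_closedSpan x)
      rintro _ ⟨⟨y, u⟩, rfl⟩
      obtain ⟨a, rfl⟩ := Xs.unit_bij.2 u
      exact subset_closedSpan ⟨(y, a), rfl⟩
    · rintro ⟨y, a⟩
      refine (mul_rep (p := p) (q := 1) rfl rfl rfl y (Xs.unit a)).trans ?_
      exact (congrArg (_ * ·) (one_rep_unit a)).trans ((p.isRep_at _ rfl).ract y a).symm

theorem deg_pow (p : FibRep hπ hr) (n : ℕ) : (p ^ n).deg = n • p.deg := by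
  induction n with
  | zero => simp [deg_one]
  | succ n ih => rw [pow_succ, deg_mul, ih, succ_nsmul]

end FibRep

/-- Two commuting fiber representations, over the two generators of `ℕ²`, extend to a covariant
representation of the product system. -/
theorem exists_psRep {Xs : PSys A 2} {r : PSRep Xs D} {hr : Function.Injective r.π} {π : A → B}
    {hπ : IsStarHom π} {p q : FibRep hπ hr} (hpq : Commute p q) (hp : p.deg = egen 0)
    (hq : q.deg = egen 1) :
    ∃ R : PSRep Xs B, PSCPCov R ∧ R.π = π ∧ (∀ x, R.ψ (egen 0) x = p.rep _ hp x) ∧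
      ∀ x, R.ψ (egen 1) x = q.rep _ hq x := by
  have hdeg : ∀ s : Fin 2 → ℕ, (p ^ s 0 * q ^ s 1).deg = s := by
    intro s
    rw [FibRep.deg_mul, FibRep.deg_pow, FibRep.deg_pow, hp, hq]
    funext i
    fin_cases i <;> simp [egen]
  refine ⟨⟨π, fun s => (p ^ s 0 * q ^ s 1).rep s (hdeg s), fun s => FibRep.isRep_at _ _ _,
    fun a => ?_, fun s t x y => ?_⟩, fun s => ?_, rfl, fun x => ?_, fun x => ?_⟩
  · exact (FibRep.rep_congr (by simp) _ FibRep.deg_one _).trans (FibRep.one_rep_unit a)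
  · have h : (p ^ s 0 * q ^ s 1) * (p ^ t 0 * q ^ t 1) =
        p ^ (s + t) 0 * q ^ (s + t) 1 := by
      rw [Pi.add_apply, Pi.add_apply, pow_add, pow_add, mul_assoc, mul_assoc,
        ← mul_assoc (q ^ s 1), (hpq.pow_pow _ _).symm.eq, mul_assoc]
    rw [← FibRep.mul_rep (hdeg s) (hdeg t) (by rw [h, hdeg])]
    exact FibRep.rep_congr h _ _ _
  · exact (FibRep.isRep_at _ _ _).cpCov ((r.isRep _).cauchySchwarz hr)
      (FibRep.mem_compactPart_at _ _ _)
  · exact FibRep.rep_congr (by simp [egen]) _ _ _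
  · exact FibRep.rep_congr (by simp [egen]) _ _ _

end FiberRepresentations

section Transport

variable {W V : Corr A} {π : A → B}

/-- The inverse of an isomorphism of correspondences. -/
def CorrIso.symm (e : CorrIso W V) : CorrIso V W where
  toFun := e.invFun
  invFun := e.toFun
  left_inv := e.right_inv
  right_inv := e.left_inv
  map_add x y := by
    conv_lhs => rw [← e.right_inv x, ← e.right_inv y, ← e.map_add, e.left_inv]
  map_smul c x := by
    conv_lhs => rw [← e.right_inv x, ← e.map_smul, e.left_inv]
  map_inner x y := by
    conv_rhs => rw [← e.right_inv x, ← e.right_inv y, e.map_inner]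
  map_ract x a := by
    conv_lhs => rw [← e.right_inv x, ← e.map_ract, e.left_inv]
  map_lact a x := by
    conv_lhs => rw [← e.right_inv x, ← e.map_lact, e.left_inv]

theorem IsRep.comp_iso {t : V.X → B} (h : IsRep V π t) (e : CorrIso W V) :
    IsRep W π fun x => t (e.toFun x) where
  hom := h.hom
  t_add x y := by rw [e.map_add, h.t_add]
  t_smul c x := by rw [e.map_smul, h.t_smul]
  lact a x := by rw [e.map_lact, h.lact]
  ract x a := by rw [e.map_ract, h.ract]
  inner x y := by rw [h.inner, e.map_inner]

theorem compactPart_comp_iso (t : V.X → B) (e : CorrIso W V) :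
    compactPart (fun x => t (e.toFun x)) = compactPart t := by
  have : {c | ∃ x y, c = t (e.toFun x) * star (t (e.toFun y))} =
      {c | ∃ x y, c = t x * star (t y)} := by
    ext c
    constructor
    · rintro ⟨x, y, rfl⟩
      exact ⟨_, _, rfl⟩
    · rintro ⟨x, y, rfl⟩
      exact ⟨e.invFun x, e.invFun y, by simp [e.right_inv]⟩
  unfold compactPart
  rw [this]

theorem IsRep.comp_hom {D : Type u} [NonUnitalCStarAlgebra D] {ρ : B → D} (hρ : IsStarHom ρ)
    {t : W.X → B} (h : IsRep W π t) : IsRep W (fun a => ρ (π a)) fun x => ρ (t x) where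
  hom := hρ.comp h.hom
  t_add x y := by rw [h.t_add, hρ.map_add]
  t_smul c x := by rw [h.t_smul, hρ.map_smul]
  lact a x := by rw [h.lact, hρ.map_mul]
  ract x a := by rw [h.ract, hρ.map_mul]
  inner x y := by rw [← hρ.map_star, ← hρ.map_mul, h.inner]

theorem compactPart_comp_hom {D : Type u} [NonUnitalCStarAlgebra D] {ρ : B → D}
    (hρ : IsStarHom ρ) {t : W.X → B} {b : B} (hb : b ∈ compactPart t) :
    ρ b ∈ compactPart fun x => ρ (t x) := by
  refine closedSpan_map_mem (isClosed_closedSpan _) hρ.clm ?_ hb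
  rintro _ ⟨x, y, rfl⟩
  exact subset_closedSpan ⟨x, y, by simp [hρ.map_mul, hρ.map_star]⟩

theorem Corr.lactL_ract (W : Corr A) (a : A) (x : W.X) (b : A) :
    W.lactL a (W.ract x b) = W.ract (W.lactL a x) b := by
  have key : ∀ z, W.inner z (W.lactL a (W.ract x b) - W.ract (W.lactL a x) b) = 0 := by
    intro z
    rw [W.inner_sub_right, W.inner_ract_right, ← (Corr.adjointPair_lactL a).symm,
      ← (Corr.adjointPair_lactL a).symm, W.inner_ract_right, sub_self]
  have h := W.norm_eq (W.lactL a (W.ract x b) - W.ract (W.lactL a x) b)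
  rw [key, norm_zero] at h
  exact sub_eq_zero.1 (norm_eq_zero.1 (pow_eq_zero_iff two_ne_zero |>.1 h))

theorem Corr.ract_mem_closedSpan (W : Corr A) (x : W.X) :
    x ∈ closedSpan (Set.range fun p : W.X × A => W.ract p.1 p.2) := by
  obtain ⟨l, hl0, hl, -, hl1⟩ := exists_isIncreasingApproximateUnit A
  exact (isClosed_closedSpan _).mem_of_tendsto (W.tendsto_ract hl hl1 x)
    (Eventually.of_forall fun e => subset_closedSpan ⟨(x, e), rfl⟩)

/-- The orbit map `a ↦ a x`, as a continuous linear map. -/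
def IsRep.lactCLM {t : W.X → B} (h : IsRep W π t) (hi : Function.Injective π) (x : W.X) :
    A →L[ℂ] W.X :=
  LinearMap.mkContinuous
    ⟨⟨fun a => W.lactL a x, fun a b => by rw [W.lact_add, _root_.add_apply]⟩,
      fun c a => by simp [W.lact_smul]⟩ ‖x‖
    fun a => by
      change ‖W.lactL a x‖ ≤ _
      rw [← h.norm_eq hi, h.lact, mul_comm]
      refine (_root_.norm_mul_le _ _).trans ?_
      gcongr
      · exact h.hom.norm_le a
      · exact h.norm_le x

end Transport

section MixedTensor

variable {W : Corr A} {O : Type u} [NonUnitalCStarAlgebra O] {ρ : A → O} {Z : Corr O}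
  {m : W.X → O → Z.X} {σ : O → B} {τ : Z.X → B}

theorem MixedMod.mem_closedSpan (h : MixedMod W O ρ Z m) (z : Z.X) :
    z ∈ closedSpan (Set.range fun p : W.X × O => m p.1 p.2) := by
  have hs : (Set.range fun p : W.X × O => m p.1 p.2) = {z | ∃ x S, z = m x S} := by
    ext z
    simp [eq_comm]
  rw [hs]
  exact closedSpan_eq_top h.dense z

/-- The map `x ↦ x ⊗ S`, as a continuous linear map. -/
def MixedMod.tmulCLM (h : MixedMod W O ρ Z m) (hρ : IsStarHom ρ) (S : O) : W.X →L[ℂ] Z.X :=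
  LinearMap.mkContinuous
    ⟨⟨fun x => m x S, fun x y => h.add_left x y S⟩, fun c x => h.smul_left c x S⟩ ‖S‖
    fun x => by
      change ‖m x S‖ ≤ _
      refine le_of_sq_le_sq ?_ (by positivity)
      rw [Z.norm_eq, h.inner]
      calc _ ≤ ‖star S‖ * (‖ρ (W.inner x x)‖ * ‖S‖) :=
            (_root_.norm_mul_le _ _).trans (by gcongr; exact _root_.norm_mul_le _ _)
        _ ≤ ‖S‖ * (‖x‖ ^ 2 * ‖S‖) := by
          rw [norm_star, W.norm_eq]
          gcongr
          exact hρ.norm_le _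
        _ = _ := by ring

/-- A representation of `W ⊗ O` restricts to a representation of `W`. -/
theorem MixedMod.exists_restrict (h : MixedMod W O ρ Z m) (hρ : IsStarHom ρ)
    (hW : W.CauchySchwarz) (hlact : ∀ a y S, Z.lactL (ρ a) (m y S) = m (W.lactL a y) S)
    (hτ : IsRep Z σ τ) :
    ∃ ψ : W.X → B, IsRep W (fun a => σ (ρ a)) ψ ∧ ∀ y S, τ (m y S) = ψ y * σ S := by
  obtain ⟨ψ, hψ, hψm⟩ := exists_isRep_of_inner hW (hτ.hom.comp hρ)
    (fun p : W.X × A => W.ract p.1 p.2) (fun p => τ (m p.1 (ρ p.2))) W.ract_mem_closedSpan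
    (by
      rintro ⟨x, a⟩ ⟨y, b⟩
      simp only [hτ.inner, h.inner, W.inner_ract_left, W.inner_ract_right, hρ.map_mul,
        hρ.map_star])
    (by
      rintro t ht - a ⟨x, b⟩
      have := ht (W.lactL a x, b)
      simp only at this
      rw [W.lactL_ract, this, ← hτ.lact, hlact])
  refine ⟨ψ, hψ, fun y S => ?_⟩
  refine closedSpan_ext (L := hτ.clm.comp (h.tmulCLM hρ S))
    (M := ((ContinuousLinearMap.mul ℂ B).flip (σ S)).comp hψ.clm) ?_ (W.ract_mem_closedSpan y)
  rintro _ ⟨⟨x, a⟩, rfl⟩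
  change τ (m (W.ract x a) S) = ψ (W.ract x a) * σ S
  rw [hψm (x, a), ← hτ.ract, h.ract, h.balanced]

theorem MixedMod.mem_rangeIdeal (h : MixedMod W O ρ Z m) (hτ : IsRep Z σ τ) {ψ : W.X → B}
    (hψm : ∀ y S, τ (m y S) = ψ y * σ S) (z : Z.X) : τ z ∈ rangeIdeal ψ := by
  refine closedSpan_map_mem (isClosed_closedSpan _) hτ.clm ?_ (h.mem_closedSpan z)
  rintro _ ⟨⟨y, S⟩, rfl⟩
  exact subset_closedSpan ⟨y, σ S, hψm y S⟩

/-- If `W` is regular, then a covariant faithful representation of `W ⊗ O` restricts to a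
covariant representation of `W`. -/
theorem MixedMod.mem_compactPart_restrict (h : MixedMod W O ρ Z m) (hW : W.CauchySchwarz)
    (hreg : W.Regular) (hτ : IsRep Z σ τ) (hσ : Function.Injective σ) (hcov : CPCov Z σ τ)
    {ψ : W.X → B} (hψ : IsRep W (fun a => σ (ρ a)) ψ) (hψm : ∀ y S, τ (m y S) = ψ y * σ S)
    (a : A) : σ (ρ a) ∈ compactPart ψ := by
  have hrange : ∀ y, ∃ z, τ z = ψ y := by
    have hiso : Isometry hτ.clm :=
      AddMonoidHomClass.isometry_of_norm _ (hτ.norm_eq hσ)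
    have hcl : IsClosed ((LinearMap.range (hτ.clm : Z.X →ₗ[ℂ] B) : Submodule ℂ B) : Set B) :=
      hiso.isClosedEmbedding.isClosed_range
    intro y
    refine hψ.mem_of_forall_mul' hcl y fun b => ?_
    exact ⟨m y (ρ b), hψm y (ρ b)⟩
  choose j hj using hrange
  obtain ⟨N, x, y, hxy⟩ := hreg.exists_tendsto a
  have hlim : Tendsto (fun n => ∑ r, Z.rankOne (j (x n r)) (j (y n r))) atTop
      (𝓝 (Z.lactL (ρ a))) := by
    rw [tendsto_iff_norm_sub_tendsto_zero] at hxy ⊢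
    refine squeeze_zero (fun n => norm_nonneg _) (fun n => ?_) hxy
    rw [norm_sub_rev, norm_sub_rev _ (W.lactL a)]
    refine ContinuousLinearMap.opNorm_le_bound _ (norm_nonneg _) fun z => ?_
    have h1 := hψ.norm_sub_sum_mul_le hW a (x n) (y n) (h.mem_rangeIdeal hτ hψm z)
    rw [hτ.norm_eq hσ] at h1
    refine le_of_eq_of_le ?_ h1
    rw [← hτ.norm_eq hσ]
    simp [sub_mul, Finset.sum_mul, hτ.map_sub, hτ.map_sum, hτ.lact, hτ.rankOne, sum_apply, hj]
  have h2 := hcov (ρ a) N _ _ hlim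
  simp only [hj] at h2
  exact (isClosed_closedSpan _).mem_of_tendsto h2
    (Eventually.of_forall fun n => sum_mem fun r _ => subset_closedSpan ⟨_, _, rfl⟩)

end MixedTensor

section FlipCorrespondence

variable {Y₁ Y₂ T T' : Corr A} {mT : Y₁.X → Y₂.X → T.X} {mT' : Y₂.X → Y₁.X → T'.X}
  {θ : CorrIso T T'} {C : CPAlg Y₁} {Z : Corr C.O} {m : Y₂.X → C.O → Z.X}
  {σ : C.O → B} {ψ : Y₂.X → B} {Ψ : T'.X → B}

/-- The representation of `Y₁` and the restriction to `Y₂` of a representation of `Y₂ ⊗ 𝒪(Y₁)`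
are intertwined by the flip. -/
theorem ECorrData.mul_eq (h : ECorrData Y₁ Y₂ T mT T' mT' θ.toFun C Z m)
    (hT' : IsTensor Y₂ Y₁ T' mT') {τ : Z.X → B} (hτ : IsRep Z σ τ)
    (hψ : IsRep Y₂ (fun a => σ (C.π a)) ψ)
    (hψm : ∀ y S, τ (m y S) = ψ y * σ S)
    (hΨ : IsRep T' (fun a => σ (C.π a)) Ψ) (hΨm : ∀ y u, Ψ (mT' y u) = ψ y * σ (C.t u))
    (x : Y₁.X) (y : Y₂.X) : σ (C.t x) * ψ y = Ψ (θ.toFun (mT x y)) := by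
  obtain ⟨μ, hμ, hμm, hμθ⟩ := h.lact_t
  have hμΨ : ∀ S v, τ (μ v S) = Ψ v * σ S := by
    intro S v
    let M : T'.X →L[ℂ] Z.X := ⟨⟨⟨fun v => μ v S, (hμ S).map_add⟩, (hμ S).map_smul⟩, (hμ S).cont⟩
    refine hT'.rep_ext (t := hτ.clm.comp M)
      (t' := ((ContinuousLinearMap.mul ℂ B).flip (σ S)).comp hΨ.clm) (fun y u => ?_) v
    change τ (μ (mT' y u) S) = Ψ (mT' y u) * σ S
    rw [hμm, hψm, hΨm, hτ.hom.map_mul, mul_assoc]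
  have key : ∀ S, σ (C.t x) * ψ y * σ S = Ψ (θ.toFun (mT x y)) * σ S := by
    intro S
    rw [mul_assoc, ← hψm, ← hτ.lact, hμθ, hμΨ]
  obtain ⟨l, hl0, hl, -, hl1⟩ := exists_isIncreasingApproximateUnit A
  have h1 := (hψ.tendsto_mul hl hl1 y).const_mul (σ (C.t x))
  simp only [← mul_assoc, key] at h1
  exact tendsto_nhds_unique h1 (hΨ.tendsto_mul hl hl1 _)

/-- A closed *-subalgebra-like predicate holding on the generators of the Cuntz–Pimsner algebra
holds everywhere. -/
theorem CPAlg.induction (C : CPAlg Y₁) {p : C.O → Prop} (hcl : IsClosed {b | p b})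
    (hπ : ∀ a, p (C.π a)) (ht : ∀ x, p (C.t x)) (hadd : ∀ b c, p b → p c → p (b + c))
    (hmul : ∀ b c, p b → p c → p (b * c)) (hsmul : ∀ (s : ℂ) b, p b → p (s • b))
    (hstar : ∀ b, p b → p (star b)) (b : C.O) : p b :=
  C.gen {b | p b} hcl hπ ht hadd hmul hsmul hstar b

/-- Intertwined representations of `Y₁` and `Y₂` induce a representation of `Y₂ ⊗ 𝒪(Y₁)`. -/
theorem ECorrData.exists_induce (h : ECorrData Y₁ Y₂ T mT T' mT' θ.toFun C Z m)
    (hT : IsTensor Y₁ Y₂ T mT) (hT' : IsTensor Y₂ Y₁ T' mT')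
    {D : Type u} [NonUnitalCStarAlgebra D] {σ' : C.O → D} {τ' : Z.X → D}
    (hτ' : IsRep Z σ' τ') (hσ' : Function.Injective σ')
    (hσ : IsStarHom σ) (hσM : ∀ a, σ (C.π a) ∈ compactPart fun x => σ (C.t x))
    (hψ : IsRep Y₂ (fun a => σ (C.π a)) ψ)
    (hΨ : IsRep T' (fun a => σ (C.π a)) Ψ) (hΨm : ∀ y u, Ψ (mT' y u) = ψ y * σ (C.t u))
    (hcomm : ∀ x y, σ (C.t x) * ψ y = Ψ (θ.toFun (mT x y))) :
    ∃ τ : Z.X → B, IsRep Z σ τ ∧ ∀ y S, τ (m y S) = ψ y * σ S := by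
  have hC := C.isRep.comp_hom hσ
  suffices hlact : ∀ t : Z.X →L[ℂ] B, (∀ p : Y₂.X × C.O, t (m p.1 p.2) = ψ p.1 * σ p.2) →
      (∀ x y, star (t x) * t y = σ (Z.inner x y)) →
      ∀ (b : C.O) (p : Y₂.X × C.O), t (Z.lactL b (m p.1 p.2)) = σ b * (ψ p.1 * σ p.2) by
    obtain ⟨τ, hτ, hτm⟩ := exists_isRep_of_inner (hτ'.cauchySchwarz hσ') hσ
      (fun p : Y₂.X × C.O => m p.1 p.2) (fun p => ψ p.1 * σ p.2) h.mod.mem_closedSpan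
      (by
        rintro ⟨x, S⟩ ⟨y, S'⟩
        simp only [h.mod.inner, hσ.map_mul, hσ.map_star, ← hψ.inner, star_mul, mul_assoc])
      hlact
    exact ⟨τ, hτ, fun y S => hτm (y, S)⟩
  intro t htm htin
  set N : Submodule ℂ B := closedSpan (Set.range fun p : Y₂.X × C.O => ψ p.1 * σ p.2) with hN
  have hNcl : IsClosed (N : Set B) := isClosed_closedSpan _
  have htN : ∀ z, t z ∈ N := by
    intro z
    refine closedSpan_map_mem hNcl t ?_ (h.mod.mem_closedSpan z)
    rintro _ ⟨p, rfl⟩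
    exact subset_closedSpan ⟨p, (htm p).symm⟩
  have hext : ∀ b, (∀ y S, t (Z.lactL b (m y S)) = σ b * t (m y S)) →
      ∀ z, t (Z.lactL b z) = σ b * t z := by
    intro b hb z
    refine closedSpan_ext (L := t.comp (Z.lactL b))
      (M := (ContinuousLinearMap.mul ℂ B (σ b)).comp t) ?_ (h.mod.mem_closedSpan z)
    rintro _ ⟨⟨y, S⟩, rfl⟩
    exact hb y S
  have hgenπ : ∀ a z, t (Z.lactL (C.π a) z) = σ (C.π a) * t z := by
    intro a
    refine hext _ fun y S => ?_
    rw [h.lact_pi, htm (_, S), htm (y, S), hψ.lact, mul_assoc]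
  have hgent : ∀ x z, t (Z.lactL (C.t x) z) = σ (C.t x) * t z := by
    intro x
    obtain ⟨μ, hμ, hμm, hμθ⟩ := h.lact_t
    refine hext _ fun y S => ?_
    rw [hμθ, htm (y, S), ← mul_assoc, hcomm]
    let M : T'.X →L[ℂ] Z.X := ⟨⟨⟨fun v => μ v S, (hμ S).map_add⟩, (hμ S).map_smul⟩, (hμ S).cont⟩
    refine hT'.rep_ext (t := t.comp M)
      (t' := ((ContinuousLinearMap.mul ℂ B).flip (σ S)).comp hΨ.clm) (fun y u => ?_) _
    change t (μ (mT' y u) S) = Ψ (mT' y u) * σ S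
    rw [hμm, htm (_, _), hΨm, hσ.map_mul, mul_assoc]
  have hstarN : ∀ x z, star (σ (C.t x)) * t z ∈ N := by
    intro x z
    set L := ContinuousLinearMap.mul ℂ B (star (σ (C.t x))) with hL
    set N' : Submodule ℂ B := N.comap (L : B →ₗ[ℂ] B) with hN'
    have hN'cl : IsClosed (N' : Set B) := hNcl.preimage L.continuous
    refine closedSpan_map_mem (N := N) hNcl (L.comp t) ?_ (h.mod.mem_closedSpan z)
    rintro _ ⟨⟨y, S⟩, rfl⟩
    change t (m y S) ∈ N'
    rw [htm (y, S)]
    refine hψ.mem_of_forall_mul hN'cl y _ fun a => ?_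
    refine closedSpan_map_mem (N := N') hN'cl
      (((ContinuousLinearMap.mul ℂ B).flip (σ S)).comp (ContinuousLinearMap.mul ℂ B (ψ y)))
      ?_ (hσM a)
    rintro _ ⟨u, v, rfl⟩
    change ψ y * (σ (C.t u) * star (σ (C.t v))) * σ S ∈ N'
    have h1 : ψ y * (σ (C.t u) * star (σ (C.t v))) * σ S =
        Ψ (θ.toFun (θ.invFun (mT' y u))) * σ (star (C.t v) * S) := by
      rw [θ.right_inv, hΨm, hσ.map_mul, hσ.map_star]
      simp only [mul_assoc]
    rw [h1]
    refine closedSpan_map_mem (N := N') hN'cl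
      (((ContinuousLinearMap.mul ℂ B).flip (σ (star (C.t v) * S))).comp (hΨ.comp_iso θ).clm)
      ?_ (hT.mem_closedSpan _)
    rintro _ ⟨⟨x', y'⟩, rfl⟩
    change star (σ (C.t x)) * (Ψ (θ.toFun (mT x' y')) * σ (star (C.t v) * S)) ∈ N
    rw [← hcomm, ← mul_assoc, ← mul_assoc, hC.inner, ← hψ.lact]
    exact subset_closedSpan ⟨(_, _), rfl⟩
  have hgood : ∀ b, (∀ z, t (Z.lactL b z) = σ b * t z) ∧
      ∀ z, t (Z.lactL (star b) z) = σ (star b) * t z := by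
    intro b
    induction b using CPAlg.induction with
    | hcl =>
      have hc : ∀ z, Continuous fun b => t (Z.lactL b z) := fun z =>
        t.continuous.comp (hτ'.lactCLM hσ' z).continuous
      have hs := hσ.continuous
      simp only [Set.ofPred_and, Set.ofPred_forall]
      refine (isClosed_iInter fun z => isClosed_eq (hc z) (by fun_prop)).inter
        (isClosed_iInter fun z => isClosed_eq ((hc z).comp continuous_star) (by fun_prop))
    | hπ a =>
      refine ⟨hgenπ a, fun z => ?_⟩
      rw [← C.isRep.hom.map_star]
      exact hgenπ _ z
    | ht x =>
      refine ⟨hgent x, fun z => ?_⟩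
      rw [← sub_eq_zero]
      set e := t (Z.lactL (star (C.t x)) z) - σ (star (C.t x)) * t z with he
      have heN : e ∈ N := by
        refine sub_mem (htN _) ?_
        rw [hσ.map_star]
        exact hstarN x z
      have horth : ∀ w, star (t w) * e = 0 := by
        intro w
        have h1 : star (t w) * (σ (star (C.t x)) * t z) = star (t (Z.lactL (C.t x) w)) * t z := by
          rw [hgent, star_mul, hσ.map_star, mul_assoc]
        rw [he, mul_sub, h1, htin, htin, Z.lact_adjoint, sub_self]
      have hNe : ∀ n ∈ N, star e * n = 0 := by
        intro n hn
        refine closedSpan_ext (L := ContinuousLinearMap.mul ℂ B (star e)) (M := 0) ?_ hn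
        rintro _ ⟨p, rfl⟩
        have := congrArg star (horth (m p.1 p.2))
        simpa [htm p] using this
      exact (CStarRing.star_mul_self_eq_zero_iff _).1 (hNe e heN)
    | hadd b c hb hc =>
      constructor <;> intro z
      · rw [Z.lact_add, _root_.add_apply, map_add, hb.1, hc.1, hσ.map_add, add_mul]
      · rw [star_add, Z.lact_add, _root_.add_apply, map_add, hb.2, hc.2, hσ.map_add, add_mul]
    | hmul b c hb hc =>
      constructor <;> intro z
      · rw [Z.lact_mul, ContinuousLinearMap.comp_apply, hb.1, hc.1, hσ.map_mul, mul_assoc]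
      · rw [star_mul, Z.lact_mul, ContinuousLinearMap.comp_apply, hc.2, hb.2, hσ.map_mul,
          mul_assoc]
    | hsmul s b hb =>
      constructor <;> intro z
      · rw [Z.lact_smul, _root_.smul_apply, map_smul, hb.1, hσ.map_smul, smul_mul_assoc]
      · rw [star_smul, Z.lact_smul, _root_.smul_apply, map_smul, hb.2, hσ.map_smul,
          smul_mul_assoc]
    | hstar b hb => exact ⟨hb.2, by simpa using hb.1⟩
  rintro b ⟨y, S⟩
  rw [(hgood b).1, htm (y, S)]

/-- The representation of `Y₂ ⊗ 𝒪(Y₁)` induced by covariant representations is covariant. -/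
theorem ECorrData.mem_compactPart_induce (hσM : ∀ a, σ (C.π a) ∈ compactPart ψ)
    (hψ : IsRep Y₂ (fun a => σ (C.π a)) ψ) {τ : Z.X → B} (hτ : IsRep Z σ τ)
    (hτm : ∀ y S, τ (m y S) = ψ y * σ S) (b : C.O) : σ b ∈ compactPart τ := by
  have hσ := hτ.hom
  set N := compactPart τ
  have hNcl : IsClosed (N : Set B) := isClosed_closedSpan _
  have hleft : ∀ b, ∀ c ∈ N, σ b * c ∈ N := by
    intro b c hc
    refine closedSpan_map_mem hNcl (ContinuousLinearMap.mul ℂ B (σ b)) ?_ hc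
    rintro _ ⟨z, w, rfl⟩
    exact subset_closedSpan ⟨Z.lactL b z, w, by simp [hτ.lact, mul_assoc]⟩
  have hψτ : ∀ y z, ψ y * star (τ z) ∈ N := fun y z =>
    hψ.mem_of_forall_mul hNcl y _ fun a => subset_closedSpan ⟨m y (C.π a), z, by rw [hτm]⟩
  have hψψ : ∀ y y', ψ y * star (ψ y') ∈ N := fun y y' =>
    hψ.mem_of_forall_mul hNcl y _ fun a => by
      have := star_mem_compactPart (hψτ y' (m y (C.π a)))
      rwa [star_mul, star_star, hτm] at this
  have hπ : ∀ a, σ (C.π a) ∈ N := fun a =>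
    closedSpan_le hNcl (by rintro _ ⟨y, y', rfl⟩; exact hψψ y y') (hσM a)
  induction b using CPAlg.induction with
  | hcl => exact hNcl.preimage hσ.continuous
  | hπ a => exact hπ a
  | ht x => exact (C.isRep.comp_hom hσ).mem_of_forall_mul' hNcl x fun a => hleft _ _ (hπ a)
  | hadd b c hb hc => rw [hσ.map_add]; exact add_mem hb hc
  | hmul b c _ hc => rw [hσ.map_mul]; exact hleft b _ hc
  | hsmul s b hb => rw [hσ.map_smul]; exact N.smul_mem s hb
  | hstar b hb => rw [hσ.map_star]; exact star_mem_compactPart hb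

end FlipCorrespondence

section Main

variable {Xs : PSys A 2}

/-- A *-homomorphism on the Cuntz–Pimsner algebra of a product system over `ℕ²` is determined by
its values on the generating fibers. -/
theorem PSCPAlg.hom_ext (CX : PSCPAlg Xs) {Φ Φ' : CX.O → B} (hΦ : IsStarHom Φ)
    (hΦ' : IsStarHom Φ') (hπ : ∀ a, Φ (CX.rep.π a) = Φ' (CX.rep.π a))
    (hψ : ∀ i x, Φ (CX.rep.ψ (egen i) x) = Φ' (CX.rep.ψ (egen i) x)) (z : CX.O) :
    Φ z = Φ' z := by
  let P : (Fin 2 → ℕ) → Prop := fun s => ∀ x, Φ (CX.rep.ψ s x) = Φ' (CX.rep.ψ s x)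
  have h0 : P 0 := by
    intro x
    obtain ⟨a, rfl⟩ := Xs.unit_bij.2 x
    rw [CX.rep.ψ_zero, hπ]
  have hadd : ∀ s t, P s → P t → P (s + t) := by
    intro s t hs ht z
    refine (Xs.isTensor s t).rep_ext (t := hΦ.clm.comp (CX.rep.isRep (s + t)).clm)
      (t' := hΦ'.clm.comp (CX.rep.isRep (s + t)).clm) (fun x y => ?_) z
    change Φ (CX.rep.ψ (s + t) (Xs.mul s t x y)) = Φ' (CX.rep.ψ (s + t) (Xs.mul s t x y))
    rw [← CX.rep.mul, hΦ.map_mul, hΦ'.map_mul, hs, ht]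
  have hnsmul : ∀ (n : ℕ) i, P (n • egen i) := by
    intro n i
    induction n with
    | zero => rwa [zero_nsmul]
    | succ n ih => rw [succ_nsmul]; exact hadd _ _ ih (hψ i)
  have hP : ∀ s, P s := by
    intro s
    have : s = s 0 • egen 0 + s 1 • egen 1 := by
      funext i
      fin_cases i <;> simp [egen]
    rw [this]
    exact hadd _ _ (hnsmul _ _) (hnsmul _ _)
  refine CX.gen {z | Φ z = Φ' z} (isClosed_eq hΦ.continuous hΦ'.continuous) hπ hP
    ?_ ?_ ?_ ?_ z
  · intro p q (hp : Φ p = Φ' p) (hq : Φ q = Φ' q)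
    change Φ (p + q) = Φ' (p + q)
    rw [hΦ.map_add, hΦ'.map_add, hp, hq]
  · intro p q (hp : Φ p = Φ' p) (hq : Φ q = Φ' q)
    change Φ (p * q) = Φ' (p * q)
    rw [hΦ.map_mul, hΦ'.map_mul, hp, hq]
  · intro c p (hp : Φ p = Φ' p)
    change Φ (c • p) = Φ' (c • p)
    rw [hΦ.map_smul, hΦ'.map_smul, hp]
  · intro p (hp : Φ p = Φ' p)
    change Φ (star p) = Φ' (star p)
    rw [hΦ.map_star, hΦ'.map_star, hp]

/-- A *-homomorphism on the Cuntz–Pimsner algebra of a correspondence is determined by its values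
on the generators. -/
theorem CPAlg.hom_ext {W : Corr A} (C : CPAlg W) {Φ Φ' : C.O → B} (hΦ : IsStarHom Φ)
    (hΦ' : IsStarHom Φ') (hπ : ∀ a, Φ (C.π a) = Φ' (C.π a)) (ht : ∀ x, Φ (C.t x) = Φ' (C.t x))
    (b : C.O) : Φ b = Φ' b := by
  induction b using CPAlg.induction with
  | hcl => exact isClosed_eq hΦ.continuous hΦ'.continuous
  | hπ a => exact hπ a
  | ht x => exact ht x
  | hadd b c hb hc => rw [hΦ.map_add, hΦ'.map_add, hb, hc]
  | hmul b c hb hc => rw [hΦ.map_mul, hΦ'.map_mul, hb, hc]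
  | hsmul s b hb => rw [hΦ.map_smul, hΦ'.map_smul, hb]
  | hstar b hb => rw [hΦ.map_star, hΦ'.map_star, hb]

variable {G : GenSys A 2} (gen : Generates G Xs) (C1 : CPAlg (G.Y 0)) {Z : Corr C1.O}
  {mm : (G.Y 1).X → C1.O → Z.X} (CX : PSCPAlg Xs) (C2 : CPAlg Z)

/-- The canonical map `𝒪(X) → 𝒪(Y₂ ⊗ 𝒪(Y₁))`. -/
theorem exists_hom_to_iterated (hZ : ECorr G 0 1 C1 Z mm) : ∃ h : CX.O →⋆ₙₐ[ℂ] C2.O,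
    (∀ a, h (CX.rep.π a) = C2.π (C1.π a)) ∧
    (∀ x, h (CX.rep.ψ (egen 0) ((gen.ι 0).toFun x)) = C2.π (C1.t x)) ∧
    ∀ y S, C2.t (mm y S) = h (CX.rep.ψ (egen 1) ((gen.ι 1).toFun y)) * C2.π S := by
  have hσ := C2.isRep.hom
  have hCS : (G.Y 1).CauchySchwarz :=
    ((CX.rep.isRep _).comp_iso (gen.ι 1)).cauchySchwarz CX.inj
  obtain ⟨ψ₁, hψ₁, hψ₁m⟩ := hZ.mod.exists_restrict C1.isRep.hom hCS hZ.lact_pi C2.isRep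
  have hM₁ := hZ.mod.mem_compactPart_restrict hCS (G.reg 1).2 C2.isRep C2.inj C2.covariant hψ₁ hψ₁m
  have hψ₀ := C1.isRep.comp_hom hσ
  have hM₀ : ∀ a, C2.π (C1.π a) ∈ compactPart fun x => C2.π (C1.t x) := fun a =>
    compactPart_comp_hom hσ (C1.covariant.mem_compactPart (G.reg 0).2 a)
  let P₀ : FibRep (Xs := Xs) (hσ.comp C1.isRep.hom) (r := CX.rep) CX.inj :=
    FibRep.mk (egen 0) _ (hψ₀.comp_iso (gen.ι 0).symm)
      fun a => by
        rw [compactPart_comp_iso (fun x => C2.π (C1.t x)) (gen.ι 0).symm]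
        exact hM₀ a
  let P₁ : FibRep (Xs := Xs) (hσ.comp C1.isRep.hom) (r := CX.rep) CX.inj :=
    FibRep.mk (egen 1) _ (hψ₁.comp_iso (gen.ι 1).symm)
      fun a => by rw [compactPart_comp_iso _ (gen.ι 1).symm]; exact hM₁ a
  have hP₀ : ∀ x, P₀.rep (egen 0) rfl ((gen.ι 0).toFun x) = C2.π (C1.t x) := fun x =>
    congrArg (fun x => C2.π (C1.t x)) ((gen.ι 0).left_inv x)
  have hP₁ : ∀ x, P₁.rep (egen 1) rfl ((gen.ι 1).toFun x) = ψ₁ x := fun x =>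
    congrArg ψ₁ ((gen.ι 1).left_inv x)
  have hcomm : Commute P₀ P₁ := by
    refine FibRep.ext_of_total (s := egen 0 + egen 1) (s' := egen 1 + egen 0) rfl rfl
      (add_comm _ _)
      (fun p : (Xs.fib (egen 0)).X × (Xs.fib (egen 1)).X => Xs.mul _ _ p.1 p.2)
      (fun p => (gen.κ 1 0).toFun ((G.θ 0 1).toFun
        (G.tmul 0 1 ((gen.ι 0).invFun p.1) ((gen.ι 1).invFun p.2))))
      (Xs.isTensor _ _).mem_closedSpan ?_ ?_
    · rintro ⟨x, y⟩
      have := gen.κ_mul 0 1 ((gen.ι 0).invFun x) ((gen.ι 1).invFun y)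
      rw [(gen.ι 0).right_inv, (gen.ι 1).right_inv] at this
      rw [← this]
      exact (gen.θ_compat 0 1 _).symm
    · rintro ⟨x, y⟩
      refine (FibRep.mul_rep (p := P₀) (q := P₁) rfl rfl rfl x y).trans ?_
      refine ECorrData.mul_eq hZ (G.isTensor 1 0) C2.isRep hψ₁ hψ₁m
        (((P₁ * P₀).isRep_at (egen 1 + egen 0) rfl).comp_iso (gen.κ 1 0)) (fun y u => ?_) _ _
      rw [gen.κ_mul]
      refine (FibRep.mul_rep (p := P₁) (q := P₀) rfl rfl rfl _ _).trans ?_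
      exact congrArg₂ (· * ·) (hP₁ y) (hP₀ u)
  obtain ⟨R, hR, hRπ, hR₀, hR₁⟩ := exists_psRep hcomm rfl rfl
  obtain ⟨h, ⟨hhπ, hhψ⟩, -⟩ := CX.universal _ R hR
  refine ⟨h, fun a => ?_, fun x => ?_, fun y S => ?_⟩
  · rw [hhπ, hRπ]
  · rw [hhψ, hR₀, hP₀]
  · rw [hhψ, hR₁, hP₁, hψ₁m]

/-- The canonical map `𝒪(Y₂ ⊗ 𝒪(Y₁)) → 𝒪(X)`. -/
theorem exists_hom_from_iterated (hZ : ECorr G 0 1 C1 Z mm) : ∃ h : C2.O →⋆ₙₐ[ℂ] CX.O,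
    (∀ a, h (C2.π (C1.π a)) = CX.rep.π a) ∧
    (∀ x, h (C2.π (C1.t x)) = CX.rep.ψ (egen 0) ((gen.ι 0).toFun x)) ∧
    ∀ y S, h (C2.t (mm y S)) = CX.rep.ψ (egen 1) ((gen.ι 1).toFun y) * h (C2.π S) := by
  have hψ : ∀ i, IsRep (G.Y i) CX.rep.π fun x => CX.rep.ψ (egen i) ((gen.ι i).toFun x) :=
    fun i => (CX.rep.isRep _).comp_iso (gen.ι i)
  have hM : ∀ i a, CX.rep.π a ∈
      compactPart fun x => CX.rep.ψ (egen i) ((gen.ι i).toFun x) := by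
    intro i a
    rw [compactPart_comp_iso _ (gen.ι i)]
    exact (CX.covariant _).mem_compactPart (Xs.reg _).2 a
  obtain ⟨ρ, ⟨hρπ, hρt⟩, -⟩ := C1.universal _ _ _ (hψ 0)
    ((hψ 0).cpCov ((hψ 0).cauchySchwarz CX.inj) (hM 0))
  have hρ := IsStarHom.of_bundle ρ
  have hπρ : CX.rep.π = fun a => ρ (C1.π a) := funext fun a => (hρπ a).symm
  have htρ : (fun x => CX.rep.ψ (egen 0) ((gen.ι 0).toFun x)) = fun x => ρ (C1.t x) :=
    funext fun x => (hρt x).symm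
  have hσM : ∀ i a, ρ (C1.π a) ∈
      compactPart fun x => CX.rep.ψ (egen i) ((gen.ι i).toFun x) := by
    intro i a
    rw [hρπ]
    exact hM i a
  have hψ₁ : IsRep (G.Y 1) (fun a => ρ (C1.π a)) fun x =>
      CX.rep.ψ (egen 1) ((gen.ι 1).toFun x) := hπρ ▸ hψ 1
  have hΨ : IsRep (G.T 1 0) (fun a => ρ (C1.π a)) fun x =>
      CX.rep.ψ (egen 1 + egen 0) ((gen.κ 1 0).toFun x) :=
    hπρ ▸ (CX.rep.isRep _).comp_iso (gen.κ 1 0)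
  obtain ⟨τ, hτ, hτm⟩ := ECorrData.exists_induce hZ (G.isTensor 0 1) (G.isTensor 1 0) C2.isRep
    C2.inj hρ (htρ ▸ hσM 0) hψ₁ hΨ
    (fun y u => by rw [gen.κ_mul, ← CX.rep.mul, hρt])
    (fun x y => by
      rw [hρt, CX.rep.mul, ← gen.κ_mul 0 1]
      exact (CX.rep.apply_heq (add_comm _ _) (gen.θ_compat 0 1 _)).symm)
  obtain ⟨h, ⟨hhπ, hht⟩, -⟩ := C2.universal _ _ _ hτ
    (hτ.cpCov (C2.isRep.cauchySchwarz C2.inj)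
      (ECorrData.mem_compactPart_induce (hσM 1) hψ₁ hτ hτm))
  refine ⟨h, fun a => ?_, fun x => ?_, fun y S => ?_⟩
  · rw [hhπ, hρπ]
  · rw [hhπ, hρt]
  · rw [hht, hhπ, hτm]

end Main

/-- Lemma `firstiso`.  Let `X` be a product system over
`ℕ²` of nondegenerate regular `A`-correspondences with generating system
`(Y, θ)`, `Y_i = X_{e_i}`.  Then `𝒪(X) ≅ 𝒪(Y₂ ⊗_A 𝒪(Y₁))`, where
`ℰY₂ = Y₂ ⊗_A 𝒪(Y₁)` is the `𝒪(Y₁)`-correspondence whose left action is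
determined by `θ₁₂`. -/
theorem CP_of_N2_product_system_iso_CP_of_EY2
    {A : Type u} [NonUnitalCStarAlgebra A]
    (G : GenSys A 2) (Xs : PSys A 2) (gen : Generates G Xs)
    (C1 : CPAlg (G.Y 0))
    (Z : Corr C1.O) (mm : (G.Y 1).X → C1.O → Z.X)
    (hZ : ECorr G 0 1 C1 Z mm)
    (CX : PSCPAlg Xs) (C2 : CPAlg Z) :
    Nonempty (CX.O ≃⋆ₐ[ℂ] C2.O) := by
  obtain ⟨h₁, h₁π, h₁0, h₁1⟩ := exists_hom_to_iterated gen C1 CX C2 hZ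
  obtain ⟨h₂, h₂π, h₂0, h₂1⟩ := exists_hom_from_iterated gen C1 CX C2 hZ
  have i₁ := IsStarHom.of_bundle h₁
  have i₂ := IsStarHom.of_bundle h₂
  have left_inv : ∀ z, h₂ (h₁ z) = z := by
    refine CX.hom_ext (i₂.comp i₁) (IsStarHom.of_bundle (.id ℂ CX.O)) (fun a => ?_) fun i x => ?_
    · simp [h₁π, h₂π]
    obtain ⟨y, rfl⟩ : ∃ y, (gen.ι i).toFun y = x := ⟨_, (gen.ι i).right_inv x⟩
    fin_cases i
    · simp [h₁0, h₂0]
    · obtain ⟨l, hl0, hl, -, hl1⟩ := exists_isIncreasingApproximateUnit A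
      have h := (CX.rep.isRep (egen 1)).tendsto_mul hl hl1 ((gen.ι 1).toFun y)
      refine tendsto_nhds_unique (((i₂.comp i₁).continuous.tendsto _).comp h) (h.congr fun a => ?_)
      have := h₂1 y (C1.π a)
      rw [h₁1, map_mul, h₂π] at this
      simp [h₁π, h₂π, this]
  have right_inv : ∀ z, h₁ (h₂ z) = z := by
    have hid : IsStarHom (fun z : C2.O => z) := IsStarHom.of_bundle (.id ℂ C2.O)
    have hπ : ∀ b, h₁ (h₂ (C2.π b)) = C2.π b :=
      C1.hom_ext ((i₁.comp i₂).comp C2.isRep.hom) C2.isRep.hom (fun a => by rw [h₂π, h₁π])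
        fun x => by rw [h₂0, h₁0]
    refine C2.hom_ext (i₁.comp i₂) hid hπ fun z => ?_
    refine closedSpan_ext (L := (i₁.comp i₂).clm.comp C2.isRep.clm) (M := C2.isRep.clm) ?_
      (hZ.mod.mem_closedSpan z)
    rintro _ ⟨⟨y, S⟩, rfl⟩
    change h₁ (h₂ (C2.t (mm y S))) = C2.t (mm y S)
    rw [h₂1, map_mul, hπ, ← h₁1]
  exact ⟨.ofBijective h₁ ⟨Function.LeftInverse.injective left_inv,
    Function.RightInverse.surjective right_inv⟩⟩
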